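/- arXiv:1401.0125 — 5 statements merged into one kernel-verified Lean document; each statement's English description precedes it below -/
import Mathlib

section
/- Let Γ be a group with a metric d (e.g. a word metric), let δ ≥ 0, and let k > 1 be such that #B(x, n) ≤ k^n for every x ∈ Γ and every integer n ≥ 0, where B(x, r) = {y ∈ Γ : d(x,y) ≤ r}. Let C ≥ 0, ε > 0 and let h : Γ × Γ → (Γ → ℝ) be a function such that for all x, x', a ∈ Γ: supp h(x,a) ⊆ B(a, 10δ); #supp h(x,a) ≤ k; and ‖h(x,a) − h(x',a)‖₁ ≤ C e^{−ε (x|x')_a}, where (x|x')_a = (d(x,a) + d(x',a) − d(x,x'))/2 is the Gromov product. Then for every real q > ln(k)/ε and all x, x' ∈ Γ, the sum Σ over pairs (a,b) ∈ Γ × Γ with d(a,b) ≤ 10δ of |h(x,a)(b) − h(x',a)(b)|^q is finite. -/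
open Function

noncomputable section

/-- In a metric space whose balls of radius `n` have at most `k ^ n` points, the function
`exp (-s * dist x a)` of `a` is summable as soon as `log k < s`. -/
lemma summable_exp_neg_mul_dist {X : Type*} [MetricSpace X] {k : ℝ} (hk : 0 < k) (x : X)
    (hfin : ∀ n : ℕ, {y : X | dist x y ≤ (n : ℝ)}.Finite)
    (hcard : ∀ n : ℕ, (Nat.card {y : X | dist x y ≤ (n : ℝ)} : ℝ) ≤ k ^ n)
    {s : ℝ} (hs : Real.log k < s) (hs0 : 0 ≤ s) :
    Summable (fun a : X => Real.exp (-s * dist x a)) := by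
  classical
  let F : ℕ × X → ℝ := fun p =>
    Set.indicator {y : X | dist x y ≤ (p.1 : ℝ)} (fun _ => Real.exp (-s) ^ p.1) p.2
  have hF0 : 0 ≤ F := fun p => Set.indicator_nonneg (fun _ _ => by positivity) _
  have hr : k * Real.exp (-s) < 1 := by
    rw [← Real.exp_log hk, ← Real.exp_add, Real.exp_lt_one_iff]
    linarith
  have hFs : Summable F := by
    refine (summable_prod_of_nonneg hF0).2 ⟨fun n => ?_, ?_⟩
    · exact summable_of_hasFiniteSupport ((hfin n).subset Set.support_indicator_subset)
    · refine Summable.of_nonneg_of_le (fun n => tsum_nonneg fun a => hF0 (n, a)) (fun n => ?_)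
        (summable_geometric_of_lt_one (by positivity) hr)
      have : ∑' a, F (n, a) = (Nat.card {y : X | dist x y ≤ (n : ℝ)} : ℝ) * Real.exp (-s) ^ n := by
        change ∑' a, Set.indicator {y : X | dist x y ≤ (n : ℝ)} (fun _ => Real.exp (-s) ^ n) a = _
        rw [← tsum_subtype, tsum_const, nsmul_eq_mul]
      rw [this, mul_pow]
      exact mul_le_mul_of_nonneg_right (hcard n) (by positivity)
  have hinj : Injective (fun a : X => (⌈dist x a⌉₊, a)) := fun a b hab => (Prod.ext_iff.1 hab).2
  refine Summable.of_nonneg_of_le (fun a => (Real.exp_pos _).le) (fun a => ?_)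
    ((hFs.comp_injective hinj).mul_left (Real.exp s))
  have hmem : a ∈ {y : X | dist x y ≤ (⌈dist x a⌉₊ : ℝ)} := Nat.le_ceil (dist x a)
  have hlt := Nat.ceil_lt_add_one (dist_nonneg (x := x) (y := a))
  simp only [comp_apply, F, Set.indicator_of_mem hmem]
  rw [← Real.exp_nat_mul, ← Real.exp_add, Real.exp_le_exp]
  nlinarith

/-- If `f` and `g` have at most `k` points in their supports and `|f - g|` sums to at most `M`,
then `|f - g| ^ q` is summable, with sum at most `2 * k * M ^ q`. -/
lemma summable_abs_sub_rpow_and_tsum_le {X : Type*} {f g : X → ℝ} {k M q : ℝ} (hq : 0 < q)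
    (hf : (support f).Finite) (hg : (support g).Finite)
    (hfk : (Nat.card (support f) : ℝ) ≤ k) (hgk : (Nat.card (support g) : ℝ) ≤ k)
    (hM : ∑' b, |f b - g b| ≤ M) :
    Summable (fun b => |f b - g b| ^ q) ∧ ∑' b, |f b - g b| ^ q ≤ 2 * k * M ^ q := by
  classical
  let T : Finset X := hf.toFinset ∪ hg.toFinset
  have hT : ∀ b ∉ T, f b - g b = 0 := by
    intro b hb
    simp only [T, Finset.mem_union, Set.Finite.mem_toFinset, mem_support, not_or, not_not] at hb
    rw [hb.1, hb.2, sub_zero]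
  have hTq : ∀ b ∉ T, |f b - g b| ^ q = 0 := fun b hb => by
    rw [hT b hb, abs_zero, Real.zero_rpow hq.ne']
  have hsum : Summable (fun b => |f b - g b|) :=
    summable_of_ne_finset_zero (s := T) fun b hb => by rw [hT b hb, abs_zero]
  have hle : ∀ b, |f b - g b| ≤ M := fun b =>
    (hsum.le_tsum b fun _ _ => abs_nonneg _).trans hM
  have hcard : (T.card : ℝ) ≤ 2 * k := by
    have h1 : (T.card : ℝ) ≤ hf.toFinset.card + hg.toFinset.card := by
      exact_mod_cast Finset.card_union_le _ _
    rw [Nat.card_coe_set_eq, Set.ncard_eq_toFinset_card _ hf] at hfk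
    rw [Nat.card_coe_set_eq, Set.ncard_eq_toFinset_card _ hg] at hgk
    linarith
  have hM0 : 0 ≤ M := (tsum_nonneg fun _ => abs_nonneg _).trans hM
  refine ⟨summable_of_ne_finset_zero hTq, ?_⟩
  rw [tsum_eq_sum hTq]
  calc ∑ b ∈ T, |f b - g b| ^ q ≤ T.card • M ^ q :=
        Finset.sum_le_card_nsmul _ _ _ fun b _ =>
          Real.rpow_le_rpow (abs_nonneg _) (hle b) hq.le
    _ = T.card * M ^ q := nsmul_eq_mul _ _
    _ ≤ 2 * k * M ^ q := mul_le_mul_of_nonneg_right hcard (Real.rpow_nonneg hM0 q)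

/-- Mineyev–Yu summability estimate. Let `Γ` be a group with a metric
`d`, `δ ≥ 0`, and `k > 1` with `#B(x,n) ≤ k^n` for all `x` and all integers `n ≥ 0`. Let
`C ≥ 0`, `ε > 0`, and `h : Γ × Γ → (Γ → ℝ)` be such that `supp h(x,a) ⊆ B(a,10δ)`,
`#supp h(x,a) ≤ k`, and `‖h(x,a) − h(x',a)‖₁ ≤ C e^{−ε(x|x')_a}`. Then for every
`q > ln k / ε` and all `x, x'`, the sum over pairs `(a,b)` with `d(a,b) ≤ 10δ` of
`|h(x,a)(b) − h(x',a)(b)|^q` is finite. -/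
theorem statement6 {Γ : Type} [Group Γ] [MetricSpace Γ]
    (δ : ℝ) (hδ : 0 ≤ δ) (k : ℝ) (hk : 1 < k)
    (hball_fin : ∀ (x : Γ) (n : ℕ), {y : Γ | dist x y ≤ (n : ℝ)}.Finite)
    (hball_card : ∀ (x : Γ) (n : ℕ), (Nat.card {y : Γ | dist x y ≤ (n : ℝ)} : ℝ) ≤ k ^ n)
    (C : ℝ) (hC : 0 ≤ C) (ε : ℝ) (hε : 0 < ε)
    (h : Γ → Γ → Γ → ℝ)
    (hsupp_fin : ∀ x a : Γ, (support (h x a)).Finite)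
    (hsupp : ∀ x a b : Γ, h x a b ≠ 0 → dist a b ≤ 10 * δ)
    (hsupp_card : ∀ x a : Γ, (Nat.card (support (h x a)) : ℝ) ≤ k)
    (hlip : ∀ x x' a : Γ,
      (∑' b : Γ, |h x a b - h x' a b|) ≤
        C * Real.exp (-ε * ((dist x a + dist x' a - dist x x') / 2)))
    (q : ℝ) (hq : Real.log k / ε < q) (x x' : Γ) :
    Summable (fun ab : {ab : Γ × Γ // dist ab.1 ab.2 ≤ 10 * δ} =>
      |h x ab.1.1 ab.1.2 - h x' ab.1.1 ab.1.2| ^ q) := by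
  have hq0 : 0 < q := (div_pos (Real.log_pos hk) hε).trans hq
  have hs : Real.log k < ε * q := by rwa [div_lt_iff₀' hε] at hq
  have hexp := summable_exp_neg_mul_dist (by linarith) x (hball_fin x) (hball_card x) hs
    (by positivity)
  let D : ℝ := C * Real.exp (ε * dist x x')
  have hD : 0 ≤ D := by positivity
  have hbound : ∀ a, ∑' b, |h x a b - h x' a b| ≤ D * Real.exp (-ε * dist x a) := by
    intro a
    refine (hlip x x' a).trans ?_
    rw [mul_assoc, ← Real.exp_add]
    refine mul_le_mul_of_nonneg_left (Real.exp_le_exp.2 ?_) hC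
    have := dist_triangle x x' a
    nlinarith
  have hrow := fun a => summable_abs_sub_rpow_and_tsum_le hq0 (hsupp_fin x a) (hsupp_fin x' a)
    (hsupp_card x a) (hsupp_card x' a) (hbound a)
  have hpow : ∀ a, (D * Real.exp (-ε * dist x a)) ^ q
      = D ^ q * Real.exp (-(ε * q) * dist x a) := by
    intro a
    rw [Real.mul_rpow hD (Real.exp_pos _).le, ← Real.exp_mul]
    ring_nf
  have hall : Summable (fun p : Γ × Γ => |h x p.1 p.2 - h x' p.1 p.2| ^ q) := by
    refine (summable_prod_of_nonneg fun p => by positivity).2 ⟨fun a => (hrow a).1, ?_⟩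
    refine Summable.of_nonneg_of_le (fun a => tsum_nonneg fun b => by positivity)
      (fun a => (hrow a).2) ?_
    simp only [hpow]
    exact (hexp.mul_left _).mul_left _
  exact hall.comp_injective Subtype.val_injective

end
end

section
/- Let Γ be a group with a metric d, let δ ≥ 0, q ≥ 1, k ≥ 1, and let h : Γ × Γ → (Γ → ℝ) be a function such that for all x, a ∈ Γ: ‖h(x,a)‖₁ = 1, supp h(x,a) ⊆ B(a, 10δ), and #supp h(x,a) ≤ k. Let x, x' ∈ Γ and let A = {a ∈ Γ : supp h(x,a) ∩ supp h(x',a) = ∅}. Then the sum Σ over pairs (a,b) ∈ Γ × Γ with d(a,b) ≤ 10δ of |h(x,a)(b) − h(x',a)(b)|^q is at least 2 k^{1−q} · #A (in particular it is infinite if A is infinite). Consequently, if in addition there exist K ≥ 0 and D ≥ 0 with #A ≥ d(x,x') − K whenever d(x,x') ≥ D, then this sum is at least 2 k^{1−q} (d(x,x') − K) whenever d(x,x') ≥ D, and hence tends to infinity as d(x,x') → ∞. -/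
open Function

noncomputable section

/-- A finitely supported function with `ℓ¹` norm `1` and at most `k` points in its support has
`‖f‖_q^q ≥ k^{1-q}`. -/
theorem rpow_one_sub_le_sum_abs_rpow {ι : Type*} (t : Finset ι) (f : ι → ℝ) {q k : ℝ}
    (hq : 1 ≤ q) (hk : 0 < k) (hcard : (t.card : ℝ) ≤ k) (hf : ∑ b ∈ t, |f b| = 1) :
    k ^ (1 - q) ≤ ∑ b ∈ t, |f b| ^ q := by
  have holder := Real.rpow_sum_le_const_mul_sum_rpow t f hq
  rw [hf, Real.one_rpow] at holder
  have hS : 0 ≤ ∑ b ∈ t, |f b| ^ q := Finset.sum_nonneg fun _ _ => by positivity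
  have hmono : (t.card : ℝ) ^ (q - 1) ≤ k ^ (q - 1) :=
    Real.rpow_le_rpow (by positivity) hcard (by linarith)
  calc k ^ (1 - q) = k ^ (1 - q) * 1 := (mul_one _).symm
    _ ≤ k ^ (1 - q) * (k ^ (q - 1) * ∑ b ∈ t, |f b| ^ q) := by
        gcongr
        exact holder.trans (by gcongr)
    _ = ∑ b ∈ t, |f b| ^ q := by
        rw [← mul_assoc, ← Real.rpow_add hk]
        simp

/-- Two finitely supported functions with disjoint supports, each of `ℓ¹` norm `1` and with at
most `k` points in its support, satisfy `‖f - g‖_q^q ≥ 2 k^{1-q}`. -/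
theorem two_mul_rpow_one_sub_le_tsum_indicator {ι : Type*} (f g : ι → ℝ) {q k : ℝ}
    (hq : 1 ≤ q) (hk : 0 < k) (S : Set ι)
    (hf_fin : (support f).Finite) (hg_fin : (support g).Finite)
    (hf : ∑' b, |f b| = 1) (hg : ∑' b, |g b| = 1)
    (hf_card : (Nat.card (support f) : ℝ) ≤ k) (hg_card : (Nat.card (support g) : ℝ) ≤ k)
    (hf_sub : support f ⊆ S) (hg_sub : support g ⊆ S) (hdisj : Disjoint (support f) (support g)) :
    ENNReal.ofReal (2 * k ^ (1 - q)) ≤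
      ∑' b, S.indicator (fun b => ENNReal.ofReal (|f b - g b| ^ q)) b := by
  classical
  have sum_bound (u : ι → ℝ) (hu_fin : (support u).Finite) (hu : ∑' b, |u b| = 1)
      (hu_card : (Nat.card (support u) : ℝ) ≤ k) (hu_sub : support u ⊆ S)
      (hu_eq : ∀ b ∈ support u, |f b - g b| = |u b|) :
      ENNReal.ofReal (k ^ (1 - q)) ≤ ∑ b ∈ hu_fin.toFinset,
        S.indicator (fun b => ENNReal.ofReal (|f b - g b| ^ q)) b := by
    have hsum : ∑ b ∈ hu_fin.toFinset, |u b| = 1 := by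
      rw [← hu, tsum_eq_sum]
      intro b hb
      simpa using hb
    have hcard : (hu_fin.toFinset.card : ℝ) ≤ k := by
      rwa [Nat.card_coe_set_eq, Set.ncard_eq_toFinset_card _ hu_fin] at hu_card
    refine (ENNReal.ofReal_le_ofReal
      (rpow_one_sub_le_sum_abs_rpow _ u hq hk hcard hsum)).trans_eq ?_
    rw [ENNReal.ofReal_sum_of_nonneg fun _ _ => by positivity]
    refine Finset.sum_congr rfl fun b hb => ?_
    have hb' : b ∈ support u := hu_fin.mem_toFinset.1 hb
    rw [Set.indicator_of_mem (hu_sub hb'), hu_eq b hb']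
  have hdisj' : Disjoint hf_fin.toFinset hg_fin.toFinset := by simpa using hdisj
  have hk0 : 0 ≤ k ^ (1 - q) := by positivity
  rw [two_mul, ENNReal.ofReal_add hk0 hk0]
  refine (add_le_add
    (sum_bound f hf_fin hf hf_card hf_sub fun b hb => ?_)
    (sum_bound g hg_fin hg hg_card hg_sub fun b hb => ?_)).trans ?_
  · rw [notMem_support.1 (Set.disjoint_left.1 hdisj hb), sub_zero]
  · rw [notMem_support.1 (Set.disjoint_right.1 hdisj hb), zero_sub, abs_neg]
  · rw [← Finset.sum_union hdisj']
    exact ENNReal.sum_le_tsum _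

/-- A sum over pairs in a set `P` dominates `c` times the number of first coordinates over which
the partial sum is at least `c`. -/
theorem card_mul_le_tsum_subtype_prod {α β : Type*} (P : Set (α × β)) (F : α × β → ENNReal)
    (c : ENNReal) (s : Finset α)
    (hc : ∀ a ∈ s, c ≤ ∑' b, {b | (a, b) ∈ P}.indicator (fun b => F (a, b)) b) :
    s.card * c ≤ ∑' p : P, F p := by
  rw [tsum_subtype P F, ENNReal.tsum_prod', ← nsmul_eq_mul]
  exact (Finset.card_nsmul_le_sum s _ c hc).trans (ENNReal.sum_le_tsum s)

/-- properness estimate. Let `Γ` be a group with a metric, `δ ≥ 0`,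
`q ≥ 1`, `k ≥ 1`, and `h : Γ × Γ → (Γ → ℝ)` with `‖h(x,a)‖₁ = 1`,
`supp h(x,a) ⊆ B(a,10δ)` and `#supp h(x,a) ≤ k`. For `x, x' ∈ Γ`, let
`A = {a : supp h(x,a) ∩ supp h(x',a) = ∅}`. Then the sum over pairs `(a,b)` with
`d(a,b) ≤ 10δ` of `|h(x,a)(b) − h(x',a)(b)|^q` (computed in `ℝ≥0∞`) is at least
`2·k^{1−q}·#A` — expressed by minorizing over every finite subset of `A`. Consequently,
if `#A ≥ d(x,x') − K` whenever `d(x,x') ≥ D`, the sum is at least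
`2·k^{1−q}·(d(x,x') − K)` in that range, and it tends to infinity as `d(x,x') → ∞`. -/
theorem statement7 {Γ : Type} [Group Γ] [MetricSpace Γ]
    (δ q k : ℝ) (hδ : 0 ≤ δ) (hq : 1 ≤ q) (hk : 1 ≤ k)
    (h : Γ → Γ → Γ → ℝ)
    (hsupp_fin : ∀ x a : Γ, (support (h x a)).Finite)
    (hnorm : ∀ x a : Γ, (∑' b : Γ, |h x a b|) = 1)
    (hsupp : ∀ x a b : Γ, h x a b ≠ 0 → dist a b ≤ 10 * δ)
    (hsupp_card : ∀ x a : Γ, (Nat.card (support (h x a)) : ℝ) ≤ k) :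
    (∀ x x' : Γ, ∀ s : Finset Γ,
      (↑s : Set Γ) ⊆ {a : Γ | support (h x a) ∩ support (h x' a) = ∅} →
      ENNReal.ofReal (2 * k ^ (1 - q) * (s.card : ℝ)) ≤
        ∑' ab : {ab : Γ × Γ // dist ab.1 ab.2 ≤ 10 * δ},
          ENNReal.ofReal (|h x ab.1.1 ab.1.2 - h x' ab.1.1 ab.1.2| ^ q)) ∧
    (∀ K D : ℝ, 0 ≤ K → 0 ≤ D →
      (∀ x x' : Γ, D ≤ dist x x' →
        ∃ s : Finset Γ,
          (↑s : Set Γ) ⊆ {a : Γ | support (h x a) ∩ support (h x' a) = ∅} ∧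
          dist x x' - K ≤ (s.card : ℝ)) →
      (∀ x x' : Γ, D ≤ dist x x' →
        ENNReal.ofReal (2 * k ^ (1 - q) * (dist x x' - K)) ≤
          ∑' ab : {ab : Γ × Γ // dist ab.1 ab.2 ≤ 10 * δ},
            ENNReal.ofReal (|h x ab.1.1 ab.1.2 - h x' ab.1.1 ab.1.2| ^ q)) ∧
      (∀ M : ℝ, ∃ D' : ℝ, ∀ x x' : Γ, D' ≤ dist x x' →
        ENNReal.ofReal M ≤
          ∑' ab : {ab : Γ × Γ // dist ab.1 ab.2 ≤ 10 * δ},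
            ENNReal.ofReal (|h x ab.1.1 ab.1.2 - h x' ab.1.1 ab.1.2| ^ q))) := by
  have hk0 : 0 < k := by linarith
  have hc : 0 < 2 * k ^ (1 - q) := by positivity
  have card_bound : ∀ x x' : Γ, ∀ s : Finset Γ,
      (↑s : Set Γ) ⊆ {a : Γ | support (h x a) ∩ support (h x' a) = ∅} →
      ENNReal.ofReal (2 * k ^ (1 - q) * (s.card : ℝ)) ≤
        ∑' ab : {ab : Γ × Γ // dist ab.1 ab.2 ≤ 10 * δ},
          ENNReal.ofReal (|h x ab.1.1 ab.1.2 - h x' ab.1.1 ab.1.2| ^ q) := by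
    intro x x' s hs
    rw [mul_comm, ENNReal.ofReal_mul (Nat.cast_nonneg _), ENNReal.ofReal_natCast]
    exact card_mul_le_tsum_subtype_prod {ab : Γ × Γ | dist ab.1 ab.2 ≤ 10 * δ}
      (fun ab => ENNReal.ofReal (|h x ab.1 ab.2 - h x' ab.1 ab.2| ^ q)) _ s fun a ha =>
      two_mul_rpow_one_sub_le_tsum_indicator (h x a) (h x' a) hq hk0 _
        (hsupp_fin x a) (hsupp_fin x' a) (hnorm x a) (hnorm x' a)
        (hsupp_card x a) (hsupp_card x' a) (hsupp x a) (hsupp x' a)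
        (Set.disjoint_iff_inter_eq_empty.2 (hs ha))
  refine ⟨card_bound, fun K D _ _ hA => ?_⟩
  have dist_bound : ∀ x x' : Γ, D ≤ dist x x' →
      ENNReal.ofReal (2 * k ^ (1 - q) * (dist x x' - K)) ≤
        ∑' ab : {ab : Γ × Γ // dist ab.1 ab.2 ≤ 10 * δ},
          ENNReal.ofReal (|h x ab.1.1 ab.1.2 - h x' ab.1.1 ab.1.2| ^ q) := by
    intro x x' hD
    obtain ⟨s, hs, hcard⟩ := hA x x' hD
    exact (ENNReal.ofReal_le_ofReal (by gcongr)).trans (card_bound x x' s hs)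
  refine ⟨dist_bound, fun M => ⟨max D (K + M / (2 * k ^ (1 - q))), fun x x' hD => ?_⟩⟩
  refine (ENNReal.ofReal_le_ofReal ?_).trans (dist_bound x x' ((le_max_left _ _).trans hD))
  have hM : M / (2 * k ^ (1 - q)) ≤ dist x x' - K := by
    linarith [(le_max_right _ _).trans hD]
  rwa [div_le_iff₀' hc] at hM

end
end

section
/- Let B be a real normed vector space with topological dual B'. For x, y ∈ B and f ∈ B', the function k ↦ |𝟙{f(x) > k} − 𝟙{f(y) > k}| on ℝ is integrable with ∫_ℝ |𝟙{f(x) > k} − 𝟙{f(y) > k}| dk = |f(x) − f(y)|. Consequently, for all x, y ∈ B, the supremum over all f ∈ B' with ‖f‖ ≤ 1 of ∫_ℝ |𝟙{f(x) > k} − 𝟙{f(y) > k}| dk equals ‖x − y‖. -/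
open MeasureTheory

noncomputable section

/-- The distance between the indicators of two open lower half-lines is the indicator of the
half-open interval between their endpoints. -/
theorem abs_sub_ite_lt_eq_indicator (a b : ℝ) :
    (fun k : ℝ => |(if k < a then (1 : ℝ) else 0) - (if k < b then (1 : ℝ) else 0)|) =
      (Set.Ico (min a b) (max a b)).indicator fun _ => 1 := by
  ext k
  by_cases ha : k < a <;> by_cases hb : k < b <;> simp [ha, hb, not_lt.mp]

theorem integrable_abs_sub_ite_lt (a b : ℝ) :
    Integrable fun k : ℝ =>
      |(if k < a then (1 : ℝ) else 0) - (if k < b then (1 : ℝ) else 0)| := by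
  rw [abs_sub_ite_lt_eq_indicator, integrable_indicator_iff measurableSet_Ico]
  exact integrableOn_const measure_Ico_lt_top.ne

theorem integral_abs_sub_ite_lt (a b : ℝ) :
    ∫ k : ℝ, |(if k < a then (1 : ℝ) else 0) - (if k < b then (1 : ℝ) else 0)| = |a - b| := by
  rw [abs_sub_ite_lt_eq_indicator, integral_indicator measurableSet_Ico]
  simp [max_sub_min_eq_abs']

/-- The norm is the supremum of the absolute values of functionals in the dual unit ball. -/
theorem iSup_abs_dual_sub_eq_norm {B : Type*} [NormedAddCommGroup B] [NormedSpace ℝ B]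
    (x y : B) :
    ⨆ f : {f : B →L[ℝ] ℝ // ‖f‖ ≤ 1}, |(f : B →L[ℝ] ℝ) x - (f : B →L[ℝ] ℝ) y| = ‖x - y‖ := by
  have hle (f : {f : B →L[ℝ] ℝ // ‖f‖ ≤ 1}) :
      |(f : B →L[ℝ] ℝ) x - (f : B →L[ℝ] ℝ) y| ≤ ‖x - y‖ := by
    rw [← map_sub, ← Real.norm_eq_abs]
    simpa using f.1.le_of_opNorm_le f.2 (x - y)
  have : Nonempty {f : B →L[ℝ] ℝ // ‖f‖ ≤ 1} := ⟨⟨0, by simp⟩⟩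
  refine le_antisymm (ciSup_le hle) ?_
  obtain ⟨g, hg, hgx⟩ := exists_dual_vector'' ℝ (x - y)
  refine le_ciSup_of_le ⟨‖x - y‖, Set.forall_mem_range.mpr hle⟩ ⟨g, hg⟩ ?_
  change ‖x - y‖ ≤ |g x - g y|
  rw [← map_sub, hgx]
  exact le_abs_self _

/-- Let `B` be a real normed vector space with topological dual `B'`. For
`x, y ∈ B` and `f ∈ B'`, the function `k ↦ |𝟙{f(x) > k} − 𝟙{f(y) > k}|` on `ℝ` is
(Lebesgue-)integrable with integral `|f(x) − f(y)|`; consequently the supremum of these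
integrals over all `f` with `‖f‖ ≤ 1` equals `‖x − y‖`. -/
theorem statement9 {B : Type} [NormedAddCommGroup B] [NormedSpace ℝ B] (x y : B) :
    (∀ f : B →L[ℝ] ℝ,
      Integrable (fun k : ℝ =>
        |(if k < f x then (1 : ℝ) else 0) - (if k < f y then (1 : ℝ) else 0)|) ∧
      (∫ k : ℝ,
        |(if k < f x then (1 : ℝ) else 0) - (if k < f y then (1 : ℝ) else 0)|)
        = |f x - f y|) ∧
    (⨆ f : {f : B →L[ℝ] ℝ // ‖f‖ ≤ 1},
      ∫ k : ℝ,
        |(if k < (f : B →L[ℝ] ℝ) x then (1 : ℝ) else 0) -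
          (if k < (f : B →L[ℝ] ℝ) y then (1 : ℝ) else 0)|) = ‖x - y‖ := by
  refine ⟨fun f => ⟨integrable_abs_sub_ite_lt _ _, integral_abs_sub_ite_lt _ _⟩, ?_⟩
  simp only [integral_abs_sub_ite_lt]
  exact iSup_abs_dual_sub_eq_norm x y

end
end

section
/- Let H and G be countable discrete groups, let L be a subgroup of G, and let p > 1 with p ∉ 2ℤ ∖ {2}. Set I = G/L and W = ⊕_{i∈I} H. Assume that G has the Haagerup property, that L is co-Haagerup in G, and that H has property PL^p. Then the permutational wreath product H ≀_I G = W ⋊ G has property PL^p. -/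
open MeasureTheory Function

noncomputable section

/-- The restricted direct sum `⊕_{i∈I} H_i`: the subgroup of `Π_i H_i` consisting of
families with all but finitely many coordinates equal to the identity. -/
def restrictedDirectProduct (I : Type*) (H : I → Type*) [∀ i, Group (H i)] :
    Subgroup (∀ i, H i) where
  carrier := {f | {i | f i ≠ 1}.Finite}
  one_mem' := by
    simp
  mul_mem' := by
    intro a b ha hb
    refine (ha.union hb).subset fun i hi => ?_
    by_contra hc
    simp only [Set.mem_union, Set.mem_setOf_eq, not_or, not_not] at hc
    exact hi (by simp [Pi.mul_apply, hc.1, hc.2])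
  inv_mem' := by
    intro a ha
    refine ha.subset fun i hi => ?_
    simp only [Set.mem_setOf_eq, Pi.inv_apply, ne_eq, inv_eq_one] at hi ⊢
    exact hi

/-- The shift automorphism of `W = ⊕_{i∈I} H` induced by the action of `g ∈ G` on the
`G`-set `I`: `(ρ(g)f)_i = f_{g⁻¹·i}`. -/
def shiftMulEquiv {G I H : Type*} [Group G] [MulAction G I] [Group H] (g : G) :
    ↥(restrictedDirectProduct I fun _ => H) ≃* ↥(restrictedDirectProduct I fun _ => H) where
  toFun f := ⟨fun i => (f : ∀ _ : I, H) (g⁻¹ • i), by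
    refine (f.2.image (fun i => g • i)).subset fun i hi => ?_
    exact ⟨g⁻¹ • i, hi, by simp⟩⟩
  invFun f := ⟨fun i => (f : ∀ _ : I, H) (g • i), by
    refine (f.2.image (fun i => g⁻¹ • i)).subset fun i hi => ?_
    exact ⟨g • i, hi, by simp⟩⟩
  left_inv f := Subtype.ext (funext fun i => by simp)
  right_inv f := Subtype.ext (funext fun i => by simp)
  map_mul' f₁ f₂ := rfl

/-- The shift action `ρ : G → Aut(⊕_{i∈I} H)`, `ρ(g)((h_i)_i) = (h_{g⁻¹·i})_i`. -/
def wreathShift (G I H : Type*) [Group G] [MulAction G I] [Group H] :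
    G →* MulAut ↥(restrictedDirectProduct I fun _ => H) where
  toFun g := shiftMulEquiv (H := H) g
  map_one' := by
    ext f i
    simp [shiftMulEquiv]
  map_mul' g₁ g₂ := by
    ext f i
    simp [shiftMulEquiv, mul_smul]

/-- The permutational wreath product `H ≀_I G = (⊕_I H) ⋊ G`, where `G` acts by shift. -/
abbrev PermutationalWreathProduct (H G I : Type*) [Group H] [Group G] [MulAction G I] :=
  ↥(restrictedDirectProduct I fun _ => H) ⋊[wreathShift G I H] G

/-- A conditionally negative definite kernel. -/
def IsCondNegDefKernel {I : Type*} (ψ : I → I → ℝ) : Prop :=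
  (∀ i, ψ i i = 0) ∧ (∀ i j, ψ i j = ψ j i) ∧
  ∀ (n : ℕ) (ι : Fin n → I) (lam : Fin n → ℝ), (∑ s, lam s) = 0 →
    (∑ s, ∑ t, lam s * lam t * ψ (ι s) (ι t)) ≤ 0

/-- A subgroup `L` of a countable group `G` is co-Haagerup in `G` if there is a proper
`G`-invariant conditionally negative definite kernel on `G/L`. -/
def IsCoHaagerup (G : Type*) [Group G] (L : Subgroup G) : Prop :=
  ∃ ψ : (G ⧸ L) → (G ⧸ L) → ℝ, IsCondNegDefKernel ψ ∧
    (∀ (g : G) (i j : G ⧸ L), ψ (g • i) (g • j) = ψ i j) ∧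
    (∀ (i₀ : G ⧸ L) (R : ℝ), {i : G ⧸ L | ψ i i₀ ≤ R}.Finite)

/-- A countable discrete group has the Haagerup property: it admits a proper isometric
affine action (linear part `π`, cocycle `b`) on a real Hilbert space, properness meaning
that `{g : ‖b g‖ ≤ R}` is finite for every `R`. -/
def HasHaagerupDiscrete (G : Type*) [Group G] : Prop :=
  ∃ (E : Type) (_ : NormedAddCommGroup E) (_ : InnerProductSpace ℝ E) (_ : CompleteSpace E)
    (π : G →* (E ≃ₗᵢ[ℝ] E)) (b : G → E),
    (∀ g h : G, b (g * h) = π g (b h) + b g) ∧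
    (∀ R : ℝ, {g : G | ‖b g‖ ≤ R}.Finite)

/-- A countable discrete group has property `PL^p`: it admits a proper isometric affine
action (linear part `π`, cocycle `b`) on some `L^p` space, properness meaning that
`{g : ‖b g‖ ≤ R}` is finite for every `R`. -/
def HasPLpDiscrete (G : Type*) [Group G] (p : ℝ) : Prop :=
  ∃ (Ω : Type) (_ : MeasurableSpace Ω) (μ : Measure Ω)
    (_ : Fact (1 ≤ ENNReal.ofReal p))
    (π : G →* ((Lp ℝ (ENNReal.ofReal p) μ) ≃ₗᵢ[ℝ] (Lp ℝ (ENNReal.ofReal p) μ)))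
    (b : G → Lp ℝ (ENNReal.ofReal p) μ),
    (∀ g h : G, b (g * h) = π g (b h) + b g) ∧
    (∀ R : ℝ, {g : G | ‖b g‖ ≤ R}.Finite)


/-! ### Kernels, vectors and coordinates -/

theorem IsCondNegDefKernel.finsupp_sum_nonpos {I : Type*} {ψ : I → I → ℝ}
    (hψ : IsCondNegDefKernel ψ) (c : I →₀ ℝ) (hc : c.sum (fun _ r => r) = 0) :
    c.sum (fun i r => c.sum fun j s => r * s * ψ i j) ≤ 0 := by
  classical
  let e := c.support.equivFin
  have key : ∀ f : I → ℝ, ∑ s, f (e.symm s) = ∑ i ∈ c.support, f i := fun f => by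
    rw [Equiv.sum_comp e.symm (fun i => f i)]
    exact Finset.sum_coe_sort c.support f
  have h := hψ.2.2 _ (fun s => (e.symm s : I)) (fun s => c (e.symm s))
    ((key fun i => c i).trans hc)
  rw [key fun i => ∑ t, c i * c (e.symm t) * ψ i (e.symm t)] at h
  simp_rw [fun i => key fun j => c i * c j * ψ i j] at h
  exact h

universe u in
theorem IsCondNegDefKernel.exists_inner {I : Type u} {ψ : I → I → ℝ}
    (hψ : IsCondNegDefKernel ψ) (i₀ : I) :
    ∃ (E : Type u) (_ : NormedAddCommGroup E) (_ : InnerProductSpace ℝ E) (v : I → E),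
      ∀ i j, inner ℝ (v i) (v j) = (ψ i i₀ + ψ j i₀ - ψ i j) / 2 := by
  classical
  let K : Matrix I I (ℝ →L[ℝ] ℝ) :=
    fun i j => ((ψ i i₀ + ψ j i₀ - ψ i j) / 2) • ContinuousLinearMap.id ℝ ℝ
  have hK : K.PosSemidef := by
    have iff : K.PosSemidef ↔ K.IsHermitian ∧ ∀ c : I →₀ ℝ,
        0 ≤ RCLike.re (c.sum fun x w => c.sum fun x' w' => inner ℝ (K x' x w) w') :=
      RKHS.posSemidef_tfae.out 0 2
    refine iff.mpr ⟨?_, fun c => ?_⟩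
    · refine Matrix.IsHermitian.ext fun i j => ?_
      simp only [K, star_smul, star_trivial, ← ContinuousLinearMap.one_def, star_one]
      rw [hψ.2.1 j i, add_comm (ψ j i₀)]
    · set m : ℝ := c.sum fun _ r => r with hm
      have h := hψ.finsupp_sum_nonpos (c - Finsupp.single i₀ m) (by
        rw [Finsupp.sum_sub_index (by simp)]
        simp [hm])
      have e1 : ∀ (f : I → ℝ → ℝ), (∀ i a b, f i (a - b) = f i a - f i b) →
          (c - Finsupp.single i₀ m).sum f = c.sum f - f i₀ m := fun f hf => by
        rw [Finsupp.sum_sub_index hf, Finsupp.sum_single_index (by simpa using hf i₀ 0 0)]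
      rw [e1 _ (by intros; simp [Finsupp.sum, sub_mul])] at h
      simp_rw [fun r i => e1 (fun j s => r * s * ψ i j) (by intros; ring)] at h
      simp only [hψ.1, mul_zero, sub_zero] at h
      have e2 : c.sum (fun j s => m * s * ψ i₀ j) = m * c.sum (fun j s => s * ψ j i₀) := by
        simp [Finsupp.sum, Finset.mul_sum, mul_assoc, hψ.2.1 i₀]
      have e3 : c.sum (fun i r => c.sum (fun j s => r * s * ψ i j) - r * m * ψ i i₀)
          = c.sum (fun i r => c.sum (fun j s => r * s * ψ i j))
            - m * c.sum (fun j s => s * ψ j i₀) := by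
        simp only [Finsupp.sum, Finset.sum_sub_distrib, Finset.mul_sum]
        congr 1
        exact Finset.sum_congr rfl fun _ _ => by ring
      rw [e2, e3] at h
      have e4 : c.sum (fun x w => c.sum fun x' w' => inner ℝ (K x' x w) w')
          = (m * c.sum (fun j s => s * ψ j i₀) + m * c.sum (fun j s => s * ψ j i₀)
            - c.sum (fun i r => c.sum (fun j s => r * s * ψ i j))) / 2 := by
        have : ∀ x x', inner ℝ (K x' x (c x)) (c x')
            = (c x * (c x' * ψ x' i₀) + c x' * (c x * ψ x i₀) - c x * c x' * ψ x x') / 2 := by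
          intro x x'
          simp [K, hψ.2.1 x x']
          ring
        simp only [Finsupp.sum, this, ← Finset.sum_div, Finset.sum_sub_distrib,
          Finset.sum_add_distrib, ← Finset.mul_sum, ← Finset.sum_mul, hm]
      simp only [RCLike.re_to_real]
      rw [e4]
      linarith
  have : Fact K.PosSemidef := ⟨hK⟩
  refine ⟨RKHS.OfKernel K, inferInstance, inferInstance,
    fun i => RKHS.kerFun (RKHS.OfKernel K) i (1 : ℝ), fun i j => ?_⟩
  rw [RKHS.kerFun_inner]
  change inner ℝ (1 : ℝ) ((RKHS.kerFun (RKHS.OfKernel K) j (1 : ℝ)) i) = _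
  rw [RKHS.kerFun_apply, RKHS.OfKernel.kernel_ofKernel]
  simp [K]

/-- A sequence in a real inner product space has the same Gram matrix as a sequence of finitely
supported vectors of `ℓ²`. -/
theorem exists_finsupp_gram_eq_of_seq {E : Type*} [NormedAddCommGroup E] [InnerProductSpace ℝ E]
    (v : ℕ → E) :
    ∃ a : ℕ → ℕ →₀ ℝ, ∀ m n, Finsupp.linearCombination ℝ (a n) (a m) = inner ℝ (v m) (v n) := by
  classical
  let e := InnerProductSpace.gramSchmidtNormed ℝ v
  have tri : ∀ n k, n < k → inner ℝ (e k) (v n) = 0 := fun n k h => by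
    simp [e, InnerProductSpace.gramSchmidtNormed, inner_smul_left,
      InnerProductSpace.gramSchmidt_inv_triangular ℝ v h]
  have orth : ∀ k l, k ≠ l → inner ℝ (e k) (e l) = 0 := fun k l h => by
    simp [e, InnerProductSpace.gramSchmidtNormed, inner_smul_left, inner_smul_right,
      InnerProductSpace.gramSchmidt_orthogonal ℝ v h]
  have pars : ∀ m N, m < N → ∀ y, inner ℝ (v m) y
      = ∑ k ∈ Finset.range N, inner ℝ (e k) (v m) * inner ℝ (e k) y := by
    intro m N hmN y
    have hmem : v m ∈ Submodule.span ℝ (e '' Set.Iic m) := by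
      rw [InnerProductSpace.span_gramSchmidtNormed, InnerProductSpace.span_gramSchmidt_Iic]
      exact Submodule.subset_span ⟨m, Set.self_mem_Iic, rfl⟩
    generalize v m = x at hmem ⊢
    induction hmem using Submodule.span_induction with
    | mem x hx =>
      obtain ⟨l, hl, rfl⟩ := hx
      rw [Finset.sum_eq_single l]
      · by_cases h0 : e l = 0
        · simp [h0]
        · have : ‖e l‖ = 1 := InnerProductSpace.gramSchmidtNormed_unit_length' h0
          simp [this]
      · intro k _ hk
        simp [orth k l hk]
      · intro h
        exact absurd (Finset.mem_range.2 (lt_of_le_of_lt hl hmN)) h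
    | zero => simp
    | add x z _ _ hx hz => simp [inner_add_left, inner_add_right, hx, hz, add_mul,
        Finset.sum_add_distrib]
    | smul r x _ hx => simp [inner_smul_left, inner_smul_right, hx, Finset.mul_sum, mul_assoc]
  refine ⟨fun n => Finsupp.onFinset (Finset.range (n + 1)) (fun k => inner ℝ (e k) (v n))
    fun k hk => ?_, fun m n => ?_⟩
  · by_contra h
    exact hk (tri n k (by simpa using h))
  · rw [Finsupp.linearCombination_apply, Finsupp.onFinset_sum _ (by simp), pars m (m + 1) (Nat.lt_succ_self m)]
    rfl

theorem exists_finsupp_gram_eq {I E : Type*} [Countable I] [NormedAddCommGroup E]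
    [InnerProductSpace ℝ E] (v : I → E) :
    ∃ a : I → ℕ →₀ ℝ, ∀ i j, Finsupp.linearCombination ℝ (a j) (a i) = inner ℝ (v i) (v j) := by
  obtain ⟨f, hf⟩ := Countable.exists_injective_nat I
  obtain ⟨a, ha⟩ := exists_finsupp_gram_eq_of_seq (Function.extend f v 0)
  exact ⟨fun i => a (f i), fun i j => by simp [ha, hf.extend_apply]⟩

/-! ### Linear combinations of independent Gaussian variables -/

open ProbabilityTheory in
/-- The law of a sequence of independent standard Gaussian variables. -/
def gaussianSeq : Measure (ℕ → ℝ) := Measure.infinitePi fun _ => gaussianReal 0 1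

instance : IsProbabilityMeasure gaussianSeq := by
  unfold gaussianSeq
  infer_instance

theorem measurable_linearCombination_left (c : ℕ →₀ ℝ) :
    Measurable fun ω : ℕ → ℝ => Finsupp.linearCombination ℝ ω c := by
  simp only [Finsupp.linearCombination_apply, Finsupp.sum, smul_eq_mul]
  fun_prop

open ProbabilityTheory in
theorem gaussianSeq_map_sum (c : ℕ → ℝ) (s : Finset ℕ) :
    gaussianSeq.map (∑ k ∈ s, fun ω => c k * ω k) =
      gaussianReal 0 (∑ k ∈ s, c k ^ 2).toNNReal := by
  have hind : iIndepFun (fun k (ω : ℕ → ℝ) => c k * ω k) gaussianSeq :=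
    iIndepFun_infinitePi (X := fun k x => c k * x) fun k => by fun_prop
  induction s using Finset.induction_on with
  | empty =>
    have : (∑ k ∈ (∅ : Finset ℕ), fun ω : ℕ → ℝ => c k * ω k) = fun _ => 0 := by simp; rfl
    rw [this, Measure.map_const]
    simp
  | insert k s hk ih =>
    rw [Finset.sum_insert hk, Finset.sum_insert hk,
      Real.toNNReal_add (sq_nonneg _) (Finset.sum_nonneg fun k _ => sq_nonneg _)]
    have h1 : gaussianSeq.map (fun ω => c k * ω k) = gaussianReal 0 (c k ^ 2).toNNReal := by
      have : (fun ω : ℕ → ℝ => c k * ω k) = (fun x => c k * x) ∘ fun ω => ω k := rfl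
      rw [this, ← Measure.map_map (by fun_prop) (by fun_prop), gaussianSeq,
        Measure.infinitePi_map_eval, gaussianReal_map_const_mul, mul_zero, mul_one]
      congr 1
      ext
      exact (Real.coe_toNNReal _ (sq_nonneg _)).symm
    have := gaussianReal_add_gaussianReal_of_indepFun
      (hind.indepFun_finsetSum_of_notMem (fun k => by fun_prop) hk).symm h1 ih
    rwa [zero_add] at this

open ProbabilityTheory in
theorem gaussianSeq_map_linearCombination (c : ℕ →₀ ℝ) :
    gaussianSeq.map (fun ω => Finsupp.linearCombination ℝ ω c) =
      gaussianReal 0 (Finsupp.linearCombination ℝ c c).toNNReal := by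
  have h := gaussianSeq_map_sum c c.support
  convert h using 2
  · ext ω
    simp [Finsupp.linearCombination_apply, Finsupp.sum]
  · simp [Finsupp.linearCombination_apply, Finsupp.sum, sq]

theorem linearCombination_sum_sum {S : Type*} (s : Finset S) (x : S → ℝ) (a : S → ℕ →₀ ℝ) :
    Finsupp.linearCombination ℝ (⇑(∑ i ∈ s, x i • a i)) (∑ i ∈ s, x i • a i) =
      ∑ i ∈ s, ∑ j ∈ s, x i * x j * Finsupp.linearCombination ℝ (a j) (a i) := by
  rw [map_sum]
  refine Finset.sum_congr rfl fun i _ => ?_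
  rw [map_smul, smul_eq_mul, Finsupp.linearCombination_apply, Finsupp.sum]
  simp only [Finsupp.linearCombination_apply, Finsupp.sum, Finsupp.finsetSum_apply,
    Finsupp.smul_apply, smul_eq_mul, Finset.mul_sum]
  rw [Finset.sum_comm]
  exact Finset.sum_congr rfl fun j _ => Finset.sum_congr rfl fun k _ => by ring

/-- The law of a finite Gaussian family is determined by its Gram matrix. -/
theorem gaussianSeq_map_eq_of_gram_eq_of_finite {S : Type*} [Fintype S] {a a' : S → ℕ →₀ ℝ}
    (h : ∀ i j, Finsupp.linearCombination ℝ (a j) (a i) =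
      Finsupp.linearCombination ℝ (a' j) (a' i)) :
    gaussianSeq.map (fun ω s => Finsupp.linearCombination ℝ ω (a s)) =
      gaussianSeq.map (fun ω s => Finsupp.linearCombination ℝ ω (a' s)) := by
  classical
  have hm : ∀ b : S → ℕ →₀ ℝ, Measurable fun ω : ℕ → ℝ =>
      fun s => Finsupp.linearCombination ℝ ω (b s) :=
    fun b => measurable_pi_lambda _ fun s => measurable_linearCombination_left _
  have hp : ∀ b : S → ℕ →₀ ℝ, IsProbabilityMeasure
      (gaussianSeq.map fun ω s => Finsupp.linearCombination ℝ ω (b s)) :=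
    fun b => Measure.isProbabilityMeasure_map (hm b).aemeasurable
  have := hp a
  have := hp a'
  refine Measure.ext_of_charFunDual (funext fun l => ?_)
  have key : ∀ b : S → ℕ →₀ ℝ,
      (gaussianSeq.map fun ω s => Finsupp.linearCombination ℝ ω (b s)).map l =
        gaussianSeq.map fun ω => Finsupp.linearCombination ℝ ω
          (∑ s, l (Pi.single s 1) • b s) := by
    intro b
    rw [Measure.map_map (by fun_prop) (hm b)]
    congr 1
    ext ω
    simp only [Function.comp_apply, map_sum, map_smul, smul_eq_mul]
    conv_lhs => rw [pi_eq_sum_univ' fun s => Finsupp.linearCombination ℝ ω (b s)]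
    simp only [map_sum, map_smul, smul_eq_mul]
    exact Finset.sum_congr rfl fun s _ => by
      rw [mul_comm]
  rw [charFunDual_eq_charFun_map_one, charFunDual_eq_charFun_map_one, key, key,
    gaussianSeq_map_linearCombination, gaussianSeq_map_linearCombination,
    linearCombination_sum_sum, linearCombination_sum_sum]
  simp_rw [h]

theorem gaussianSeq_map_eq_of_gram_eq {I : Type*} {a a' : I → ℕ →₀ ℝ}
    (h : ∀ i j, Finsupp.linearCombination ℝ (a j) (a i) =
      Finsupp.linearCombination ℝ (a' j) (a' i)) :
    gaussianSeq.map (fun ω i => Finsupp.linearCombination ℝ ω (a i)) =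
      gaussianSeq.map (fun ω i => Finsupp.linearCombination ℝ ω (a' i)) := by
  have hm : ∀ b : I → ℕ →₀ ℝ, Measurable fun ω : ℕ → ℝ =>
      fun s => Finsupp.linearCombination ℝ ω (b s) :=
    fun b => measurable_pi_lambda _ fun s => measurable_linearCombination_left _
  refine (ProbabilityTheory.map_eq_iff_forall_finset_map_restrict_eq
    (X := fun i ω => Finsupp.linearCombination ℝ ω (a i))
    (Y := fun i ω => Finsupp.linearCombination ℝ ω (a' i))
    (hm a).aemeasurable (hm a').aemeasurable).2 fun s => ?_
  exact gaussianSeq_map_eq_of_gram_eq_of_finite (a := fun i : s => a i) (a' := fun i : s => a' i)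
    fun i j => h i j

/-! ### An invariant measure on a product of lines -/

theorem linearCombination_sub_left (x y : ℕ → ℝ) (c : ℕ →₀ ℝ) :
    Finsupp.linearCombination ℝ (x - y) c =
      Finsupp.linearCombination ℝ x c - Finsupp.linearCombination ℝ y c := by
  simp [Finsupp.linearCombination_apply, Finsupp.sum, mul_sub]

theorem linearCombination_sub_sub {I : Type*} {ψ : I → I → ℝ} {i₀ : I} {a : I → ℕ →₀ ℝ}
    (ha : ∀ i j, Finsupp.linearCombination ℝ (a j) (a i) = (ψ i i₀ + ψ j i₀ - ψ i j) / 2)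
    (i j k l : I) :
    Finsupp.linearCombination ℝ (⇑(a j - a l)) (a i - a k) =
      (ψ i l + ψ k j - ψ i j - ψ k l) / 2 := by
  rw [Finsupp.coe_sub, linearCombination_sub_left, map_sub, map_sub, ha, ha, ha, ha]
  ring

open ProbabilityTheory in
theorem lintegral_ofReal_gaussianReal (v : NNReal) :
    ∫⁻ x, ENNReal.ofReal x ∂(gaussianReal 0 v) =
      ENNReal.ofReal √v * ∫⁻ x, ENNReal.ofReal x ∂(gaussianReal 0 1) := by
  have h : gaussianReal 0 v = (gaussianReal 0 1).map (fun x => √v * x) := by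
    rw [gaussianReal_map_const_mul, mul_zero, mul_one]
    congr 1
    ext
    exact (Real.sq_sqrt v.2).symm
  rw [h, lintegral_map (by fun_prop) (by fun_prop), ← lintegral_const_mul _ (by fun_prop)]
  exact lintegral_congr fun x => ENNReal.ofReal_mul (Real.sqrt_nonneg _)

open ProbabilityTheory in
theorem lintegral_ofReal_gaussianReal_ne_top :
    ∫⁻ x, ENNReal.ofReal x ∂(gaussianReal 0 1) ≠ ⊤ :=
  ((memLp_id_gaussianReal 1).integrable le_rfl).lintegral_lt_top.ne

open ProbabilityTheory in
theorem lintegral_ofReal_gaussianReal_ne_zero :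
    ∫⁻ x, ENNReal.ofReal x ∂(gaussianReal 0 1) ≠ 0 := by
  rw [← pos_iff_ne_zero, lintegral_pos_iff_support (by fun_prop)]
  have hs : Set.Ioi (0 : ℝ) ⊆ support fun x : ℝ => ENNReal.ofReal x := fun x hx => by
    simpa using hx
  refine lt_of_lt_of_le ?_ (measure_mono hs)
  rw [pos_iff_ne_zero]
  intro h
  have := (gaussianReal_absolutelyContinuous' 0 (one_ne_zero : (1 : NNReal) ≠ 0)) h
  simp at this

/-- A conditionally negative definite kernel `ψ` which is invariant under a group action gives an
invariant measure on the space of real functions for which the set of functions that are positive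
at `i` and nonpositive at `j` has measure proportional to `√(ψ i j)`. -/
theorem IsCondNegDefKernel.exists_invariant_measure {I G : Type*} [Countable I] [Group G]
    [MulAction G I] {ψ : I → I → ℝ} (hψ : IsCondNegDefKernel ψ)
    (hinv : ∀ (g : G) (i j : I), ψ (g • i) (g • j) = ψ i j) (i₀ : I) :
    ∃ (ν : Measure (I → ℝ)) (_ : SFinite ν) (C : ENNReal), C ≠ 0 ∧ C ≠ ⊤ ∧
      (∀ g : G, MeasurePreserving (fun (y : I → ℝ) i => y (g • i)) ν ν) ∧
      ∀ i j, ν {y | 0 < y i ∧ y j ≤ 0} = ENNReal.ofReal √(ψ i j) * C := by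
  obtain ⟨E, _, _, v, hv⟩ := hψ.exists_inner i₀
  obtain ⟨a, ha⟩ := exists_finsupp_gram_eq v
  simp only [hv] at ha
  have hm : ∀ b : I → ℕ →₀ ℝ, Measurable fun ω : ℕ → ℝ =>
      fun s => Finsupp.linearCombination ℝ ω (b s) :=
    fun b => measurable_pi_lambda _ fun s => measurable_linearCombination_left _
  have hm' : ∀ b : I → ℕ →₀ ℝ, Measurable fun (q : (ℕ → ℝ) × ℝ) i =>
      Finsupp.linearCombination ℝ q.1 (b i) - q.2 :=
    fun b => measurable_pi_lambda _ fun i =>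
      ((measurable_linearCombination_left _).comp measurable_fst).sub measurable_snd
  have hd : Measurable fun (q : (I → ℝ) × ℝ) i => q.1 i - q.2 := by fun_prop
  let M : (I → ℕ →₀ ℝ) → Measure (I → ℝ) := fun b =>
    (gaussianSeq.prod volume).map fun q i => Finsupp.linearCombination ℝ q.1 (b i) - q.2
  have hM : ∀ b, M b = ((gaussianSeq.map fun ω s => Finsupp.linearCombination ℝ ω (b s)).prod
      volume).map fun q i => q.1 i - q.2 := by
    intro b
    have : SFinite (gaussianSeq.map fun ω s => Finsupp.linearCombination ℝ ω (b s)) :=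
      inferInstance
    have h := (((hm b).measurePreserving gaussianSeq).prod
      (MeasurePreserving.id (volume : Measure ℝ)))
    rw [← h.map_eq, Measure.map_map hd h.measurable]
    rfl
  have hshift : ∀ (b : I → ℕ →₀ ℝ) (c : ℕ →₀ ℝ), M (fun i => b i - c) = M b := by
    intro b c
    have hmc := measurable_linearCombination_left c
    have hp : MeasurePreserving (fun q : (ℕ → ℝ) × ℝ =>
        (q.1, Finsupp.linearCombination ℝ q.1 c + q.2))
        (gaussianSeq.prod volume) (gaussianSeq.prod volume) :=
      (MeasurePreserving.id gaussianSeq).skew_product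
        (g := fun ω t => Finsupp.linearCombination ℝ ω c + t)
        (by fun_prop)
        (Filter.Eventually.of_forall fun ω => map_add_left_eq_self _ _)
    simp only [M]
    conv_rhs => rw [← hp.map_eq, Measure.map_map (hm' b) hp.measurable]
    congr 1
    ext q i
    simp only [Function.comp_apply, map_sub]
    ring
  have hG : ∀ g : G, M (fun i => a (g • i)) = M a := by
    intro g
    rw [← hshift _ (a (g • i₀)), ← hshift a (a i₀), hM, hM]
    congr 2
    refine gaussianSeq_map_eq_of_gram_eq fun i j => ?_
    simp only [linearCombination_sub_sub ha, hinv]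
  refine ⟨M a, inferInstance, _, lintegral_ofReal_gaussianReal_ne_zero,
    lintegral_ofReal_gaussianReal_ne_top, fun g => ⟨by fun_prop, ?_⟩, fun i j => ?_⟩
  · refine Eq.trans ?_ (hG g)
    simp only [M]
    rw [Measure.map_map (by fun_prop) (hm' a)]
    rfl
  · have hS : MeasurableSet {y : I → ℝ | 0 < y i ∧ y j ≤ 0} :=
      (measurableSet_lt measurable_const (measurable_pi_apply i)).inter
        (measurableSet_le (measurable_pi_apply j) measurable_const)
    simp only [M]
    rw [Measure.map_apply (hm' a) hS, Measure.prod_apply (hm' a hS)]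
    have h1 : ∀ ω, volume (Prod.mk ω ⁻¹' ((fun (q : (ℕ → ℝ) × ℝ) i =>
        Finsupp.linearCombination ℝ q.1 (a i) - q.2) ⁻¹' {y | 0 < y i ∧ y j ≤ 0})) =
        ENNReal.ofReal (Finsupp.linearCombination ℝ ω (a i - a j)) := by
      intro ω
      rw [map_sub, ← Real.volume_Ico]
      congr 1
      ext t
      simp [and_comm]
    simp only [h1]
    rw [← lintegral_map (f := fun x => ENNReal.ofReal x) (by fun_prop)
      (measurable_linearCombination_left _), gaussianSeq_map_linearCombination,
      lintegral_ofReal_gaussianReal, linearCombination_sub_sub ha, hψ.1, hψ.1, hψ.2.1 j i]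
    congr 3
    have : 0 ≤ ψ i j := by
      have h := linearCombination_sub_sub ha i i j j
      have h2 : 0 ≤ Finsupp.linearCombination ℝ (⇑(a i - a j)) (a i - a j) := by
        rw [Finsupp.linearCombination_apply]
        exact Finset.sum_nonneg fun k _ => mul_self_nonneg _
      rw [h, hψ.1, hψ.1, hψ.2.1 j i] at h2
      linarith
    rw [Real.coe_toNNReal _ (by linarith)]
    ring

/-! ### Sums of `L^p` spaces -/

section Sigma

variable {ι : Type*} {Ω : ι → Type*} [∀ i, MeasurableSpace (Ω i)]

theorem measurable_sigmaMk (i : ι) : Measurable (Sigma.mk i : Ω i → Σ i, Ω i) :=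
  measurable_iff_comap_le.2 (MeasurableSpace.comap_le_iff_le_map.2 (iInf_le _ i))

theorem measurable_of_comp_sigmaMk {β : Type*} [MeasurableSpace β] {f : (Σ i, Ω i) → β}
    (hf : ∀ i, Measurable fun ω => f ⟨i, ω⟩) : Measurable f := fun _ hs =>
  MeasurableSpace.measurableSet_iInf.2 fun i => hf i hs

/-- The disjoint sum of a family of measures. -/
def sigmaMeasure (μ : ∀ i, Measure (Ω i)) : Measure (Σ i, Ω i) :=
  Measure.sum fun i => (μ i).map (Sigma.mk i)

variable (μ : ∀ i, Measure (Ω i))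

theorem ae_sigmaMeasure_of_forall [Countable ι] {P : (Σ i, Ω i) → Prop}
    (hP : ∀ i, ∀ᵐ ω ∂(μ i), P ⟨i, ω⟩) : ∀ᵐ x ∂(sigmaMeasure μ), P x := by
  choose t ht htm ht0 using fun i => exists_measurable_superset_of_null (hP i)
  have hm : MeasurableSet {x : Σ i, Ω i | x.2 ∈ t x.1} :=
    MeasurableSpace.measurableSet_iInf.2 fun i => htm i
  refine measure_mono_null (t := {x : Σ i, Ω i | x.2 ∈ t x.1}) (fun x hx => ht x.1 hx) ?_
  rw [sigmaMeasure, Measure.sum_apply _ hm, ENNReal.tsum_eq_zero]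
  intro i
  rw [Measure.map_apply (measurable_sigmaMk i) hm]
  exact ht0 i

theorem lintegral_sigmaMeasure {f : (Σ i, Ω i) → ENNReal} (hf : Measurable f) :
    ∫⁻ x, f x ∂(sigmaMeasure μ) = ∑' i, ∫⁻ ω, f ⟨i, ω⟩ ∂(μ i) := by
  rw [sigmaMeasure, lintegral_sum_measure]
  exact tsum_congr fun i => lintegral_map hf (measurable_sigmaMk i)

variable {q : ENNReal}

/-- The function on the disjoint union defined by a family of functions. -/
def sigmaFun (x : ∀ i, Lp ℝ q (μ i)) : (Σ i, Ω i) → ℝ := fun y => x y.1 y.2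

theorem measurable_sigmaFun (x : ∀ i, Lp ℝ q (μ i)) : Measurable (sigmaFun μ x) :=
  measurable_of_comp_sigmaMk fun i => (Lp.stronglyMeasurable (x i)).measurable

variable [Fact (1 ≤ q)]

theorem toReal_pos_of_one_le (hq : q ≠ ⊤) : 0 < q.toReal :=
  ENNReal.toReal_pos (zero_lt_one.trans_le Fact.out).ne' hq

theorem eLpNorm_sigmaMeasure_rpow (hq : q ≠ ⊤) {f : (Σ i, Ω i) → ℝ} (hf : Measurable f) :
    eLpNorm f q (sigmaMeasure μ) ^ q.toReal =
      ∑' i, eLpNorm (fun ω => f ⟨i, ω⟩) q (μ i) ^ q.toReal := by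
  have hq0 : q ≠ 0 := (zero_lt_one.trans_le Fact.out).ne'
  have h : ∀ {α : Type _} [MeasurableSpace α] (ν : Measure α) (g : α → ℝ),
      eLpNorm g q ν ^ q.toReal = ∫⁻ x, ‖g x‖ₑ ^ q.toReal ∂ν := fun ν g => by
    rw [eLpNorm_eq_lintegral_rpow_enorm_toReal hq0 hq, ← ENNReal.rpow_mul,
      one_div_mul_cancel (toReal_pos_of_one_le hq).ne', ENNReal.rpow_one]
  rw [eLpNorm_eq_lintegral_rpow_enorm_toReal hq0 hq, ← ENNReal.rpow_mul,
      one_div_mul_cancel (toReal_pos_of_one_le hq).ne', ENNReal.rpow_one,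
    lintegral_sigmaMeasure μ (by fun_prop)]
  exact tsum_congr fun i => (h _ _).symm

theorem eLpNorm_sigmaFun_rpow (hq : q ≠ ⊤) (x : ∀ i, Lp ℝ q (μ i)) :
    eLpNorm (sigmaFun μ x) q (sigmaMeasure μ) ^ q.toReal =
      ∑' i, ENNReal.ofReal (‖x i‖ ^ q.toReal) := by
  rw [eLpNorm_sigmaMeasure_rpow μ hq (measurable_sigmaFun μ x)]
  refine tsum_congr fun i => ?_
  rw [← ENNReal.ofReal_rpow_of_nonneg (norm_nonneg _) ENNReal.toReal_nonneg, ofReal_norm,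
    Lp.enorm_def]
  rfl

theorem memLp_sigmaFun_iff (hq : q ≠ ⊤) (x : ∀ i, Lp ℝ q (μ i)) :
    MemLp (sigmaFun μ x) q (sigmaMeasure μ) ↔ Memℓp x q := by
  have h0 := toReal_pos_of_one_le hq
  have h : ∀ i, 0 ≤ ‖x i‖ ^ q.toReal := fun i => by positivity
  rw [memℓp_gen_iff h0, MemLp, and_iff_right (measurable_sigmaFun μ x).aestronglyMeasurable,
    ← ENNReal.rpow_lt_top_iff_of_pos h0, eLpNorm_sigmaFun_rpow μ hq]
  constructor
  · intro hx
    refine (ENNReal.summable_toReal hx.ne).congr fun i => ENNReal.toReal_ofReal (h i)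
  · intro hx
    exact hx.tsum_ofReal_lt_top

variable [Countable ι]

/-- The `ℓ^q` sum of the spaces `L^q(Ω i)` is the space `L^q` of the disjoint union. -/
def lpToLpSigma (hq : q ≠ ⊤) : lp (fun i => Lp ℝ q (μ i)) q →ₗᵢ[ℝ] Lp ℝ q (sigmaMeasure μ) where
  toFun x := ((memLp_sigmaFun_iff μ hq x).2 (lp.memℓp x)).toLp _
  map_add' x y := by
    rw [← MemLp.toLp_add, MemLp.toLp_eq_toLp_iff]
    exact ae_sigmaMeasure_of_forall μ fun i => Lp.coeFn_add (x i) (y i)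
  map_smul' c x := by
    rw [RingHom.id_apply, ← MemLp.toLp_const_smul, MemLp.toLp_eq_toLp_iff]
    exact ae_sigmaMeasure_of_forall μ fun i => Lp.coeFn_smul c (x i)
  norm_map' x := by
    have h0 := toReal_pos_of_one_le hq
    have h : ∀ i, 0 ≤ ‖x i‖ ^ q.toReal := fun i => by positivity
    simp only [LinearMap.coe_mk, AddHom.coe_mk, Lp.norm_toLp]
    rw [← Real.rpow_left_inj ENNReal.toReal_nonneg (norm_nonneg _) h0.ne',
      lp.norm_rpow_eq_tsum h0, ENNReal.toReal_rpow, eLpNorm_sigmaFun_rpow μ hq,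
      ENNReal.tsum_toReal_eq fun i => ENNReal.ofReal_ne_top]
    exact tsum_congr fun i => ENNReal.toReal_ofReal (h i)

theorem lpToLpSigma_surjective (hq : q ≠ ⊤) : Surjective (lpToLpSigma μ hq) := by
  intro f
  have h0 := toReal_pos_of_one_le hq
  have hf := (Lp.stronglyMeasurable f).measurable
  have hm : ∀ i, MemLp (fun ω => f ⟨i, ω⟩) q (μ i) := by
    intro i
    refine ⟨(hf.comp (measurable_sigmaMk i)).aestronglyMeasurable, ?_⟩
    rw [← ENNReal.rpow_lt_top_iff_of_pos h0]
    have h := (ENNReal.rpow_lt_top_iff_of_pos h0).2 (Lp.memLp f).2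
    rw [eLpNorm_sigmaMeasure_rpow μ hq hf] at h
    exact (ENNReal.le_tsum i).trans_lt h
  have hx : sigmaFun μ (fun i => (hm i).toLp) =ᵐ[sigmaMeasure μ] f :=
    ae_sigmaMeasure_of_forall μ fun i => (hm i).coeFn_toLp
  have hs : MemLp (sigmaFun μ fun i => (hm i).toLp) q (sigmaMeasure μ) :=
    (memLp_congr_ae hx).2 (Lp.memLp f)
  exact ⟨⟨fun i => (hm i).toLp, (memLp_sigmaFun_iff μ hq _).1 hs⟩,
    Lp.ext (hs.coeFn_toLp.trans hx)⟩

end Sigma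

/-! ### Affine isometric actions on `L^p` spaces -/

/-- The action by invertible isometries given by an action of a group by linear isometries. -/
def MonoidHom.toLinearIsometryEquiv {Γ E : Type*} [Group Γ] [NormedAddCommGroup E]
    [NormedSpace ℝ E] (ρ : Γ →* (E →ₗᵢ[ℝ] E)) : Γ →* (E ≃ₗᵢ[ℝ] E) where
  toFun g := LinearIsometryEquiv.ofSurjective (ρ g) fun x => ⟨ρ g⁻¹ x, by
    change (ρ g * ρ g⁻¹) x = x
    rw [← map_mul, mul_inv_cancel, map_one]
    rfl⟩
  map_one' := by
    ext x
    simp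
  map_mul' g h := by
    ext x
    change ρ (g * h) x = ρ g (ρ h x)
    rw [map_mul]
    rfl

/-- The group `Γ` has an affine isometric action on some `L^q` space, with cocycle `b`, such that a
bound `‖b g‖ ≤ r` implies `P g r`. -/
def LpControlled (q : ENNReal) [Fact (1 ≤ q)] (Γ : Type*) [Group Γ] (P : Γ → ℝ → Prop) : Prop :=
  ∃ (Ω : Type) (_ : MeasurableSpace Ω) (μ : Measure Ω) (π : Γ →* (Lp ℝ q μ ≃ₗᵢ[ℝ] Lp ℝ q μ))
    (b : Γ → Lp ℝ q μ), (∀ g h, b (g * h) = π g (b h) + b g) ∧ ∀ g r, ‖b g‖ ≤ r → P g r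

namespace LpControlled

variable {q : ENNReal} [Fact (1 ≤ q)] {Γ : Type*} [Group Γ]

theorem of_linearIsometryEquiv {Ω : Type} [MeasurableSpace Ω] {μ : Measure Ω} {E : Type*}
    [NormedAddCommGroup E] [NormedSpace ℝ E] (e : E ≃ₗᵢ[ℝ] Lp ℝ q μ) (ρ : Γ →* (E →ₗᵢ[ℝ] E))
    (b : Γ → E) (hb : ∀ g h, b (g * h) = ρ g (b h) + b g) {P : Γ → ℝ → Prop}
    (hP : ∀ g r, ‖b g‖ ≤ r → P g r) : LpControlled q Γ P := by
  let ρ' : Γ →* (Lp ℝ q μ →ₗᵢ[ℝ] Lp ℝ q μ) :=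
    { toFun := fun g => (e.toLinearIsometry.comp (ρ g)).comp e.symm.toLinearIsometry
      map_one' := by
        ext1 x
        simp
      map_mul' := fun g h => by
        ext1 x
        simp }
  refine ⟨Ω, _, μ, ρ'.toLinearIsometryEquiv, fun g => e (b g), fun g h => ?_, fun g r h => ?_⟩
  · simp [MonoidHom.toLinearIsometryEquiv, ρ', hb]
  · exact hP g r (by simpa using h)

/-- Affine actions on `ℓ^q` sums that permute the summands. -/
theorem of_sigma {ι : Type} [Countable ι] {Ω : ι → Type} [∀ i, MeasurableSpace (Ω i)]
    (μ : ∀ i, Measure (Ω i)) (hq : q ≠ ⊤) (ρ : Γ →* Module.End ℝ (∀ i, Lp ℝ q (μ i)))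
    (σ : Γ → Equiv.Perm ι) (hσ : ∀ g x i, ‖ρ g x i‖ = ‖x (σ g i)‖)
    (b : Γ → ∀ i, Lp ℝ q (μ i)) (hfin : ∀ g, {i | b g i ≠ 0}.Finite)
    (hb : ∀ g h, b (g * h) = ρ g (b h) + b g) {P : Γ → ℝ → Prop}
    (hP : ∀ g r, (∀ i, ‖b g i‖ ≤ r) → P g r) : LpControlled q Γ P := by
  have h0 := toReal_pos_of_one_le hq
  have hmem : ∀ g x, Memℓp x q → Memℓp (ρ g x) q := by
    intro g x hx
    rw [memℓp_gen_iff h0] at hx ⊢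
    simpa only [hσ] using! (σ g).summable_iff.2 hx
  let ρ' : Γ →* (lp (fun i => Lp ℝ q (μ i)) q →ₗᵢ[ℝ] lp (fun i => Lp ℝ q (μ i)) q) :=
    { toFun := fun g =>
        { toFun := fun x => ⟨ρ g x, hmem g x (lp.memℓp x)⟩
          map_add' := fun x y => Subtype.ext (map_add (ρ g) _ _)
          map_smul' := fun c x => Subtype.ext (map_smul (ρ g) c _)
          norm_map' := fun x => by
            simp only [LinearMap.coe_mk, AddHom.coe_mk, lp.norm_eq_tsum_rpow h0, hσ]
            rw [(σ g).tsum_eq fun i => ‖x i‖ ^ q.toReal] }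
      map_one' := by
        ext1 x
        refine Subtype.ext ?_
        change ρ 1 x = x
        rw [map_one]
        rfl
      map_mul' := fun g h => by
        ext1 x
        refine Subtype.ext ?_
        change ρ (g * h) x = ρ g (ρ h x)
        rw [map_mul]
        rfl }
  have hbm : ∀ g, Memℓp (b g) q := fun g => (memℓp_zero (hfin g)).of_exponent_ge zero_le
  exact of_linearIsometryEquiv
    (LinearIsometryEquiv.ofSurjective _ (lpToLpSigma_surjective μ hq)) ρ'
    (fun g => ⟨b g, hbm g⟩) (fun g h => Subtype.ext (hb g h)) fun g r h => hP g r fun i =>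
      (lp.norm_apply_le_norm (zero_lt_one.trans_le Fact.out).ne' (⟨b g, hbm g⟩ : lp _ q) i).trans h

theorem pi {ι : Type} [Finite ι] (hq : q ≠ ⊤) {P : ι → Γ → ℝ → Prop}
    (h : ∀ i, LpControlled q Γ (P i)) : LpControlled q Γ fun g r => ∀ i, P i g r := by
  choose Ω m μ π b hb hP using h
  let ρ : Γ →* Module.End ℝ (∀ i, Lp ℝ q (μ i)) :=
    { toFun := fun g => LinearMap.pi fun i =>
        (π i g).toLinearEquiv.toLinearMap ∘ₗ LinearMap.proj i
      map_one' := by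
        refine LinearMap.ext fun x => funext fun i => ?_
        simp
      map_mul' := fun g h => by
        refine LinearMap.ext fun x => funext fun i => ?_
        simp }
  exact of_sigma μ hq ρ (fun _ => 1) (fun g x i => (π i g).norm_map _) (fun g i => b i g)
    (fun g => Set.toFinite _) (fun g h => funext fun i => hb i g h)
    fun g r h i => hP i g r (h i)

theorem and (hq : q ≠ ⊤) {P Q : Γ → ℝ → Prop} (hP : LpControlled q Γ P)
    (hQ : LpControlled q Γ Q) : LpControlled q Γ fun g r => P g r ∧ Q g r := by
  have h : ∀ i : Bool, LpControlled q Γ (Bool.rec P Q i) := Bool.rec hP hQ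
  obtain ⟨Ω, m, μ, π, b, hb, hPQ⟩ := LpControlled.pi hq h
  exact ⟨Ω, m, μ, π, b, hb, fun g r hr => ⟨hPQ g r hr false, hPQ g r hr true⟩⟩

/-- A measure-preserving action with a measurable set which is almost invariant up to sets of
finite measure gives an affine isometric action on `L^q`. -/
theorem of_measurePreserving {Ω : Type} [MeasurableSpace Ω] {μ : Measure Ω} (hq : q ≠ ⊤)
    (T : Γ → Ω → Ω) (hT : ∀ g, MeasurePreserving (T g) μ μ) (hT1 : T 1 = id)
    (hTmul : ∀ g h, T (g * h) = T g ∘ T h) {S : Set Ω} (hS : MeasurableSet S)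
    (hfin : ∀ g, μ (S \ T g ⁻¹' S) ≠ ⊤) {P : Γ → ℝ → Prop}
    (hP : ∀ g r, μ (S \ T g⁻¹ ⁻¹' S) ≤ ENNReal.ofReal r ^ q.toReal → P g r) :
    LpControlled q Γ P := by
  have h0 := toReal_pos_of_one_le hq
  have hq0 : q ≠ 0 := (zero_lt_one.trans_le Fact.out).ne'
  have hTT : ∀ g x, T g⁻¹ (T g x) = x := fun g x => by
    rw [← Function.comp_apply (f := T g⁻¹), ← hTmul, inv_mul_cancel, hT1, id]
  let ρ : Γ →* (Lp ℝ q μ →ₗᵢ[ℝ] Lp ℝ q μ) :=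
    { toFun := fun g => Lp.compMeasurePreservingₗᵢ ℝ (T g⁻¹) (hT g⁻¹)
      map_one' := by
        ext1 f
        change Lp.compMeasurePreserving (T 1⁻¹) (hT 1⁻¹) f = f
        have h : T 1⁻¹ = id := by rw [inv_one, hT1]
        simp only [h]
        exact Lp.compMeasurePreserving_id_apply f
      map_mul' := fun g h => by
        ext1 f
        change Lp.compMeasurePreserving (T (g * h)⁻¹) (hT _) f =
          Lp.compMeasurePreserving (T g⁻¹) (hT _) (Lp.compMeasurePreserving (T h⁻¹) (hT _) f)
        rw [← Lp.compMeasurePreserving_comp_apply]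
        simp only [mul_inv_rev, hTmul] }
  let F : Γ → Ω → ℝ := fun g => S.indicator 1 ∘ T g - S.indicator 1
  have hFS : ∀ g x, F g x = (T g ⁻¹' S \ S).indicator 1 x - (S \ T g ⁻¹' S).indicator 1 x := by
    intro g x
    by_cases h1 : x ∈ S <;> by_cases h2 : T g x ∈ S <;> simp [F, h1, h2]
  have hF : ∀ g, MemLp (F g) q μ := by
    intro g
    have hm : MeasurableSet (T g ⁻¹' S) := (hT g).measurable hS
    have h1 : μ (T g ⁻¹' S \ S) ≠ ⊤ := by
      have h : T g ⁻¹' S \ S = T g ⁻¹' (S \ T g⁻¹ ⁻¹' S) := by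
        ext x
        simp [hTT]
      rw [h, (hT g).measure_preimage
        (hS.diff ((hT g⁻¹).measurable hS)).nullMeasurableSet]
      exact hfin g⁻¹
    have h2 := (memLp_indicator_const q (hm.diff hS) (1 : ℝ) (Or.inr h1)).sub
      (memLp_indicator_const q (hS.diff hm) (1 : ℝ) (Or.inr (hfin g)))
    exact (memLp_congr_ae (Filter.Eventually.of_forall (hFS g))).2 h2
  refine ⟨Ω, _, μ, ρ.toLinearIsometryEquiv, fun g => (hF g⁻¹).toLp, fun g h => ?_,
    fun g r h => hP g r ?_⟩
  · change _ = Lp.compMeasurePreserving (T g⁻¹) (hT g⁻¹) (hF h⁻¹).toLp + _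
    rw [Lp.toLp_compMeasurePreserving, ← MemLp.toLp_add]
    refine MemLp.toLp_congr _ _ (Filter.Eventually.of_forall fun x => ?_)
    simp [F, hTmul]
  · have hr := (norm_nonneg _).trans h
    rw [Lp.norm_toLp, ← ENNReal.le_ofReal_iff_toReal_le (hF g⁻¹).2.ne hr] at h
    have hle : eLpNorm ((S \ T g⁻¹ ⁻¹' S).indicator fun _ => (1 : ℝ)) q μ ≤
        eLpNorm (F g⁻¹) q μ := by
      refine eLpNorm_mono fun x => ?_
      by_cases h1 : x ∈ S <;> by_cases h2 : T g⁻¹ x ∈ S <;> simp [F, h1, h2]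
    rw [eLpNorm_indicator_const (hS.diff ((hT g⁻¹).measurable hS)) hq0 hq, enorm_one,
      one_mul] at hle
    have := ENNReal.rpow_le_rpow (hle.trans h) h0.le
    rwa [← ENNReal.rpow_mul, one_div_mul_cancel h0.ne', ENNReal.rpow_one] at this

end LpControlled

/-! ### Affine actions of permutational wreath products -/

section Wreath

variable {H G I : Type} [Group H] [Group G] [MulAction G I]

theorem wreathShift_apply (g : G) (w : ↥(restrictedDirectProduct I fun _ => H)) (i : I) :
    (wreathShift G I H g w : I → H) i = (w : I → H) (g⁻¹ • i) := rfl

instance [Countable H] [Countable I] : Countable ↥(restrictedDirectProduct I fun _ => H) := by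
  have : Countable (Additive H) := ‹Countable H›
  refine Injective.countable (f := fun w : ↥(restrictedDirectProduct I fun _ => H) =>
    Finsupp.ofSupportFinite (fun i => Additive.ofMul ((w : I → H) i)) w.2) fun v w h => ?_
  exact Subtype.ext (funext fun i => Additive.ofMul.injective (DFunLike.congr_fun h i))

instance : MeasurableSpace ↥(restrictedDirectProduct I fun _ => H) := ⊤

instance : DiscreteMeasurableSpace ↥(restrictedDirectProduct I fun _ => H) := ⟨fun _ => trivial⟩

theorem measurePreserving_count_equiv {α : Type*} [MeasurableSpace α] [DiscreteMeasurableSpace α]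
    (e : α ≃ α) : MeasurePreserving e Measure.count Measure.count := by
  refine ⟨.of_discrete, Measure.ext fun s _ => ?_⟩
  rw [Measure.map_apply .of_discrete .of_discrete, Measure.count_apply .of_discrete,
    Measure.count_apply .of_discrete, ← Equiv.image_symm_eq_preimage,
    e.symm.injective.encard_image]

open Classical in
/-- The restriction of a finitely supported family to a set of coordinates. -/
def restrictCoord (A : Set I) (w : ↥(restrictedDirectProduct I fun _ => H)) :
    ↥(restrictedDirectProduct I fun _ => H) :=
  ⟨fun i => if i ∈ A then (w : I → H) i else 1, w.2.subset fun i hi => by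
    by_contra h
    exact hi (by simp [not_not.1 h])⟩

open Classical in
theorem restrictCoord_apply (A : Set I) (w : ↥(restrictedDirectProduct I fun _ => H)) (i : I) :
    (restrictCoord A w : I → H) i = if i ∈ A then (w : I → H) i else 1 := rfl

theorem measurable_restrictCoord [Countable H] [Countable I]
    (w : ↥(restrictedDirectProduct I fun _ => H)) :
    Measurable fun y : I → ℝ => restrictCoord {i | y i ≤ 0} w := by
  refine measurable_to_countable' fun u => ?_
  have h : (fun y : I → ℝ => restrictCoord {i | y i ≤ 0} w) ⁻¹' {u} =
      ⋂ i, {y | y i ≤ 0 ∧ (w : I → H) i = (u : I → H) i ∨ ¬ y i ≤ 0 ∧ 1 = (u : I → H) i} := by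
    ext y
    simp only [Set.mem_preimage, Set.mem_singleton_iff, Subtype.ext_iff, funext_iff,
      restrictCoord_apply, Set.mem_iInter]
    refine forall_congr' fun i => ?_
    by_cases hy : y i ≤ 0 <;> simp [hy, not_le.1]
  rw [h]
  refine MeasurableSet.iInter fun i => ?_
  have hi : MeasurableSet {y : I → ℝ | y i ≤ 0} :=
    measurableSet_le (measurable_pi_apply i) measurable_const
  exact (hi.inter (.const _)).union (hi.compl.inter (.const _))

/-- The action of the wreath product on the product of the space of functions on `I` with the
direct sum, twisted by the walls `{y i = 0}`. -/
def wallAction (x : PermutationalWreathProduct H G I)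
    (z : (I → ℝ) × ↥(restrictedDirectProduct I fun _ => H)) :
    (I → ℝ) × ↥(restrictedDirectProduct I fun _ => H) :=
  (fun i => z.1 (x.right⁻¹ • i),
    restrictCoord {i | z.1 (x.right⁻¹ • i) ≤ 0} x.left * wreathShift G I H x.right z.2)

theorem wallAction_one : wallAction (1 : PermutationalWreathProduct H G I) = id := by
  ext z i
  · simp [wallAction]
  · simp [wallAction, restrictCoord_apply]

theorem wallAction_mul (x x' : PermutationalWreathProduct H G I) :
    wallAction (x * x') = wallAction x ∘ wallAction x' := by
  ext z i
  · simp [wallAction, mul_smul]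
  · simp only [wallAction, SemidirectProduct.mul_left, SemidirectProduct.mul_right,
      Function.comp_apply, Subgroup.coe_mul, Pi.mul_apply, restrictCoord_apply,
      wreathShift_apply, mul_inv_rev, mul_smul, Set.mem_ofPred_eq, map_mul]
    split_ifs <;> simp only [one_mul, mul_assoc] <;> rfl

theorem measurePreserving_wallAction [Countable H] [Countable I] {ν : Measure (I → ℝ)} [SFinite ν]
    (hν : ∀ g : G, MeasurePreserving (fun (y : I → ℝ) i => y (g • i)) ν ν)
    (x : PermutationalWreathProduct H G I) :
    MeasurePreserving (wallAction x) (ν.prod Measure.count) (ν.prod Measure.count) := by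
  refine (hν x.right⁻¹).skew_product
    (g := fun y u => restrictCoord {i | y (x.right⁻¹ • i) ≤ 0} x.left *
      wreathShift G I H x.right u) ?_ (Filter.Eventually.of_forall fun y => ?_)
  · have h1 : Measurable fun z : (I → ℝ) × ↥(restrictedDirectProduct I fun _ => H) =>
        restrictCoord {i | z.1 (x.right⁻¹ • i) ≤ 0} x.left :=
      (measurable_restrictCoord x.left).comp ((hν x.right⁻¹).measurable.comp measurable_fst)
    have h2 : Measurable fun z : (I → ℝ) × ↥(restrictedDirectProduct I fun _ => H) =>
        wreathShift G I H x.right z.2 :=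
      (Measurable.of_discrete (f := fun u => wreathShift G I H x.right u)).comp measurable_snd
    exact (Measurable.of_discrete (f := fun p : ↥(restrictedDirectProduct I fun _ => H) ×
      ↥(restrictedDirectProduct I fun _ => H) => p.1 * p.2)).comp (h1.prodMk h2)
  · exact (measurePreserving_count_equiv ((wreathShift G I H x.right).toEquiv.trans
      (Equiv.mulLeft (restrictCoord {i | y (x.right⁻¹ • i) ≤ 0} x.left)))).map_eq

/-- An invariant conditionally negative definite kernel on `I` gives an affine isometric action of
the wreath product on an `L^q` space whose cocycle controls the position of the support. -/
theorem exists_lpControlled_of_kernel [Countable H] [Countable I] {q : ENNReal} [Fact (1 ≤ q)]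
    (hq : q ≠ ⊤) {ψ : I → I → ℝ} (hψ : IsCondNegDefKernel ψ)
    (hinv : ∀ (g : G) (i j : I), ψ (g • i) (g • j) = ψ i j) (i₀ : I) :
    ∃ f : ℝ → ℝ, LpControlled q (PermutationalWreathProduct H G I) fun x r =>
      (∀ i, (x.left : I → H) i ≠ 1 → ψ i i₀ ≤ f r) ∧ ψ (x.right • i₀) i₀ ≤ f r := by
  obtain ⟨ν, _, C, hC0, hCt, hν, hνC⟩ := hψ.exists_invariant_measure hinv i₀
  let A : I → Set (I → ℝ) := fun i => {y | 0 < y i₀ ∧ y i ≤ 0}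
  have hA : ∀ i, ν (A i) ≠ ⊤ := fun i => by
    rw [hνC]
    exact ENNReal.mul_ne_top ENNReal.ofReal_ne_top hCt
  let f : ℝ → ℝ := fun r => (ENNReal.ofReal r ^ q.toReal / C).toReal ^ 2
  have hf : ∀ i r, ν (A i) ≤ ENNReal.ofReal r ^ q.toReal → ψ i i₀ ≤ f r := by
    intro i r h
    rw [hνC, ← ENNReal.le_div_iff_mul_le (Or.inl hC0) (Or.inl hCt), hψ.2.1] at h
    have ht : ENNReal.ofReal r ^ q.toReal / C ≠ ⊤ :=
      ENNReal.div_ne_top (ENNReal.rpow_ne_top_of_nonneg ENNReal.toReal_nonneg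
        ENNReal.ofReal_ne_top) hC0
    exact (Real.sqrt_le_left ENNReal.toReal_nonneg).1 ((ENNReal.ofReal_le_iff_le_toReal ht).1 h)
  have hc : ∀ B : Set (I → ℝ), (ν.prod Measure.count)
      (B ×ˢ ({1} : Set ↥(restrictedDirectProduct I fun _ => H))) = ν B := fun B => by
    rw [Measure.prod_prod, Measure.count_singleton, mul_one]
  let S : Set ((I → ℝ) × ↥(restrictedDirectProduct I fun _ => H)) := {y | 0 < y i₀} ×ˢ {1}
  have hS : MeasurableSet S :=
    (measurableSet_lt measurable_const (measurable_pi_apply i₀)).prod .of_discrete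
  refine ⟨f, LpControlled.of_measurePreserving hq wallAction (measurePreserving_wallAction hν)
    wallAction_one wallAction_mul hS (fun x => ?_) fun x r h => ⟨fun i hi => ?_, ?_⟩⟩
  · let B : Set (I → ℝ) := A (x.right⁻¹ • i₀) ∪
      ⋃ i ∈ {i | (x.left : I → H) i ≠ 1}, A (x.right⁻¹ • i)
    have hB : ν B ≠ ⊤ := (measure_union_lt_top (hA _).lt_top
      (measure_biUnion_lt_top x.left.2 fun i _ => (hA _).lt_top)).ne
    refine ne_top_of_le_ne_top (hc B ▸ hB) (measure_mono ?_)
    rintro ⟨y, u⟩ ⟨⟨hy, rfl⟩, hxy⟩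
    refine ⟨?_, rfl⟩
    by_contra hyB
    simp only [B, A, Set.mem_union, Set.mem_iUnion, Set.mem_ofPred_eq, not_or, not_exists,
      not_and, not_le] at hyB
    refine hxy ⟨hyB.1 hy, Subtype.ext (funext fun i => ?_)⟩
    simp only [wallAction, map_one, mul_one, restrictCoord_apply, Set.mem_ofPred_eq]
    split_ifs with h
    · by_contra hi
      exact (hyB.2 i hi hy).not_ge h
    · rfl
  · refine hf i r (le_trans ?_ h)
    rw [← hc]
    refine measure_mono ?_
    rintro ⟨y, u⟩ ⟨⟨hy, hyi⟩, rfl⟩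
    refine ⟨⟨hy, rfl⟩, fun hxy => hi ?_⟩
    have h1 := congr_fun (congr_arg Subtype.val hxy.2) (x.right⁻¹ • i)
    simpa [wallAction, restrictCoord_apply, hyi, wreathShift_apply, -map_inv] using! h1
  · refine hf _ r (le_trans ?_ h)
    rw [← hc]
    refine measure_mono ?_
    rintro ⟨y, u⟩ ⟨⟨hy, hyi⟩, rfl⟩
    refine ⟨⟨hy, rfl⟩, fun hxy => ?_⟩
    have h1 : 0 < y (x.right⁻¹⁻¹ • i₀) := hxy.1
    rw [inv_inv] at h1
    exact h1.not_ge hyi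

/-- An affine isometric action of `H` on `L^q` induces one of the wreath product. -/
theorem lpControlled_induced [Countable I] {q : ENNReal} [Fact (1 ≤ q)] (hq : q ≠ ⊤)
    {Ω : Type} [MeasurableSpace Ω] {μ : Measure Ω} (π : H →* (Lp ℝ q μ ≃ₗᵢ[ℝ] Lp ℝ q μ))
    (b : H → Lp ℝ q μ) (hb : ∀ g h, b (g * h) = π g (b h) + b g) :
    LpControlled q (PermutationalWreathProduct H G I) fun x r =>
      ∀ i, ‖b ((x.left : I → H) i)‖ ≤ r := by
  have hb1 : b 1 = 0 := by simpa using hb 1 1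
  let ρ : PermutationalWreathProduct H G I →* Module.End ℝ (I → Lp ℝ q μ) :=
    { toFun := fun x => LinearMap.pi fun i =>
        (π ((x.left : I → H) i)).toLinearEquiv.toLinearMap ∘ₗ LinearMap.proj (x.right⁻¹ • i)
      map_one' := by
        refine LinearMap.ext fun y => funext fun i => ?_
        simp
      map_mul' := fun x x' => by
        refine LinearMap.ext fun y => funext fun i => ?_
        simp [wreathShift_apply, mul_smul] }
  refine LpControlled.of_sigma (fun _ => μ) hq ρ (fun x => MulAction.toPerm x.right⁻¹)
    (fun x y i => (π _).norm_map _) (fun x i => b ((x.left : I → H) i))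
    (fun x => x.left.2.subset fun i hi h => hi (by rw [h, hb1])) (fun x x' => funext fun i => ?_)
    fun x r h => h
  exact hb _ _

end Wreath

/-- The kernel `‖b g - b h‖ ^ 2` of a map to a Hilbert space is conditionally negative definite. -/
theorem isCondNegDefKernel_norm_sub_sq {I E : Type*} [NormedAddCommGroup E] [InnerProductSpace ℝ E]
    (b : I → E) : IsCondNegDefKernel fun i j => ‖b i - b j‖ ^ 2 := by
  refine ⟨fun i => by simp, fun i j => by simp only [norm_sub_rev], fun n ι lam h => ?_⟩
  have h0 : ∑ s, ∑ t, lam s * lam t * ‖b (ι s) - b (ι t)‖ ^ 2 =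
      (∑ s, lam s * ‖b (ι s)‖ ^ 2) * (∑ t, lam t) + (∑ s, lam s) * (∑ t, lam t * ‖b (ι t)‖ ^ 2) -
        2 * inner ℝ (∑ s, lam s • b (ι s)) (∑ t, lam t • b (ι t)) := by
    rw [Finset.sum_mul_sum, Finset.sum_mul_sum, sum_inner]
    simp only [inner_sum, Finset.mul_sum, ← Finset.sum_add_distrib, ← Finset.sum_sub_distrib,
      norm_sub_sq_real, real_inner_smul_left, real_inner_smul_right]
    exact Finset.sum_congr rfl fun s _ => Finset.sum_congr rfl fun t _ => by ring
  rw [h0, h, real_inner_self_eq_norm_sq]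
  nlinarith [sq_nonneg ‖∑ s, lam s • b (ι s)‖]

theorem LpControlled.mono {q : ENNReal} [Fact (1 ≤ q)] {Γ : Type*} [Group Γ] {P Q : Γ → ℝ → Prop}
    (h : LpControlled q Γ P) (hPQ : ∀ g r, P g r → Q g r) : LpControlled q Γ Q := by
  obtain ⟨Ω, m, μ, π, b, hb, hP⟩ := h
  exact ⟨Ω, m, μ, π, b, hb, fun g r hr => hPQ g r (hP g r hr)⟩

theorem LpControlled.comp {q : ENNReal} [Fact (1 ≤ q)] {Γ Γ' : Type*} [Group Γ] [Group Γ']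
    {P : Γ' → ℝ → Prop} (h : LpControlled q Γ' P) (φ : Γ →* Γ') :
    LpControlled q Γ fun g => P (φ g) := by
  obtain ⟨Ω, m, μ, π, b, hb, hP⟩ := h
  exact ⟨Ω, m, μ, π.comp φ, b ∘ φ, fun g h => by simp [hb], fun g => hP (φ g)⟩

/-- A countable group with the Haagerup property acts properly on an `L^q` space. -/
theorem HasHaagerupDiscrete.lpControlled {G : Type} [Group G] [Countable G]
    (hG : HasHaagerupDiscrete G) {q : ENNReal} [Fact (1 ≤ q)] (hq : q ≠ ⊤) :
    ∃ F : ℝ → Set G, (∀ r, (F r).Finite) ∧ LpControlled q G fun g r => g ∈ F r := by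
  obtain ⟨E, _, _, _, π, b, hb, hfin⟩ := hG
  have hb1 : b 1 = 0 := by simpa using hb 1 1
  obtain ⟨f, hf⟩ := exists_lpControlled_of_kernel (H := Unit) (G := G) hq
    (isCondNegDefKernel_norm_sub_sq b) (fun g i j => by simp [hb, ← map_sub]) 1
  refine ⟨fun r => {g | ‖b g‖ ^ 2 ≤ f r}, fun r => (hfin √(f r)).subset fun g hg =>
    Real.le_sqrt_of_sq_le hg, ?_⟩
  exact (hf.comp SemidirectProduct.inr).mono fun g r h => by simpa [hb1] using h.2

/-- Let `H, G` be countable discrete groups, `L ≤ G`, and `p > 1` with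
`p ∉ 2ℤ ∖ {2}`. Set `I = G/L` and `W = ⊕_I H`. If `G` is Haagerup, `L` is co-Haagerup in
`G` and `H` has property `PL^p`, then the permutational wreath product
`H ≀_I G = W ⋊ G` has property `PL^p`. -/
theorem statement10 (p : ℝ) (hp : 1 < p) (hp2 : ∀ n : ℤ, p = 2 * (n : ℝ) → p = 2)
    (H G : Type) [Group H] [Group G] [Countable H] [Countable G] (L : Subgroup G)
    (hG : HasHaagerupDiscrete G) (hL : IsCoHaagerup G L) (hH : HasPLpDiscrete H p) :
    HasPLpDiscrete (PermutationalWreathProduct H G (G ⧸ L)) p := by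
  have hq : ENNReal.ofReal p ≠ ⊤ := ENNReal.ofReal_ne_top
  have : Countable (G ⧸ L) := QuotientGroup.mk_surjective.countable
  obtain ⟨Ω, _, μ, hp1, π, b, hb, hfin⟩ := hH
  obtain ⟨ψ, hψ, hinv, hprop⟩ := hL
  obtain ⟨F, hF, hGF⟩ := hG.lpControlled hq
  obtain ⟨f, hf⟩ := exists_lpControlled_of_kernel (H := H) (G := G) hq hψ hinv ((1 : G) : G ⧸ L)
  obtain ⟨Ω', m', μ', π', b', hb', hP⟩ := (hf.and hq
    (hGF.comp (SemidirectProduct.rightHom (φ := wreathShift G (G ⧸ L) H)))).and hq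
    (lpControlled_induced (G := G) (I := G ⧸ L) hq π b hb)
  refine ⟨Ω', m', μ', hp1, π', b', hb', fun R => ?_⟩
  have hJ : {i : G ⧸ L | ψ i ((1 : G) : G ⧸ L) ≤ f R}.Finite := hprop _ _
  have := hJ.to_subtype
  refine Set.Finite.of_injOn
    (f := fun x : PermutationalWreathProduct H G (G ⧸ L) =>
      (x.right, fun i : {i : G ⧸ L | ψ i ((1 : G) : G ⧸ L) ≤ f R} => (x.left : G ⧸ L → H) i))
    (t := F R ×ˢ Set.univ.pi fun _ => {h | ‖b h‖ ≤ R}) ?_ ?_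
    ((hF R).prod (Set.Finite.pi fun _ => hfin R))
  · intro x hx
    obtain ⟨⟨_, h2⟩, h3⟩ := hP x R hx
    exact ⟨h2, fun i _ => h3 i⟩
  · intro x hx y hy hxy
    obtain ⟨⟨⟨hx, _⟩, _⟩, _⟩ := hP x R hx
    obtain ⟨⟨⟨hy, _⟩, _⟩, _⟩ := hP y R hy
    rw [Prod.mk.injEq] at hxy
    refine SemidirectProduct.ext (Subtype.ext (funext fun i => ?_)) hxy.1
    by_cases hi : ψ i ((1 : G) : G ⧸ L) ≤ f R
    · exact congr_fun hxy.2 ⟨i, hi⟩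
    · rw [not_imp_comm.1 (hx i) hi, not_imp_comm.1 (hy i) hi]

end
end

section
/- Let G be a group, F a finite subgroup of G, and suppose G is endowed with a structure of space with labelled partitions (G, 𝒫, F(𝒫)) on which G acts by automorphisms via left translations. Then there exists a structure of space with labelled partitions (G/F, 𝒫', F'(𝒫')) on the coset space G/F, on which G acts by automorphisms via its natural action on G/F, such that F'(𝒫') is isometrically isomorphic to a closed linear subspace of F(𝒫), and there exists a constant K ≥ 0 such that for all g, g' ∈ G: ‖c(g,g')‖ − K ≤ ‖c'(gF, g'F)‖ ≤ ‖c(g,g')‖ + K, where c and c' are the respective separation maps. In particular, when G is a countable discrete group, the action of G on (G, 𝒫, F(𝒫)) is proper if and only if the action of G on (G/F, 𝒫', F'(𝒫')) is proper. -/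
open MeasureTheory Function Set

noncomputable section

/-- A space with labelled partitions `(X, 𝒫, F(𝒫))`: a set `X`, a family `P` of labelling
functions `X → ℝ`, and a subspace `Fcal` of real-valued functions on `P` equipped with a
seminorm `N` whose separated quotient is complete (a Banach space), such that every
separation function `c x y : p ↦ p x - p y` belongs to `Fcal`. -/
structure LabelledPartitionSpace (X : Type*) where
  P : Set (X → ℝ)
  Fcal : Submodule ℝ (↥P → ℝ)
  N : ↥Fcal → ℝ
  N_nonneg : ∀ ξ, 0 ≤ N ξ
  N_add_le : ∀ ξ η, N (ξ + η) ≤ N ξ + N η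
  N_smul : ∀ (a : ℝ) (ξ), N (a • ξ) = |a| * N ξ
  sep_mem : ∀ x y : X, (fun p : ↥P => (p : X → ℝ) x - (p : X → ℝ) y) ∈ Fcal
  complete : ∀ u : ℕ → ↥Fcal,
    (∀ ε : ℝ, 0 < ε → ∃ M : ℕ, ∀ m ≥ M, ∀ n ≥ M, N (u m - u n) < ε) →
    ∃ ξ : ↥Fcal, ∀ ε : ℝ, 0 < ε → ∃ M : ℕ, ∀ n ≥ M, N (u n - ξ) < ε

namespace LabelledPartitionSpace

variable {X X' : Type*}

/-- The separation map `c(x,y)(p) = p(x) - p(y)`, as an element of `ℱ(𝒫)`. -/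
def c (S : LabelledPartitionSpace X) (x y : X) : ↥S.Fcal :=
  ⟨fun p : ↥S.P => (p : X → ℝ) x - (p : X → ℝ) y, S.sep_mem x y⟩

/-- The labelled-partition pseudo-metric `d(x,y) = ‖c(x,y)‖`. -/
def dist (S : LabelledPartitionSpace X) (x y : X) : ℝ := S.N (S.c x y)

/-- A group action `act : G → X → X` is an action by automorphisms of the space with
labelled partitions `S`: it is a group action, `Φ_g(p) = p ∘ act g` maps `𝒫` to `𝒫`, and
precomposition with `Φ_g` preserves `ℱ(𝒫)` and its seminorm. -/
def IsActionByAutomorphisms {G : Type*} [Group G] (S : LabelledPartitionSpace X)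
    (act : G → X → X) : Prop :=
  (∀ x : X, act 1 x = x) ∧ (∀ (g h : G) (x : X), act (g * h) x = act g (act h x)) ∧
  ∃ hP : ∀ (g : G) (p : ↥S.P), (fun x => (p : X → ℝ) (act g x)) ∈ S.P,
    ∀ (g : G) (ξ : ↥S.Fcal),
      ∃ hmem : (fun p : ↥S.P =>
          (ξ : ↥S.P → ℝ) ⟨fun x => (p : X → ℝ) (act g x), hP g p⟩) ∈ S.Fcal,
        S.N ⟨_, hmem⟩ = S.N ξ

/-- The action is continuous: every orbit map `g ↦ act g x` is continuous for the
labelled-partition pseudo-metric. -/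
def IsContinuousAction {G : Type*} [Group G] [TopologicalSpace G]
    (S : LabelledPartitionSpace X) (act : G → X → X) : Prop :=
  ∀ (x : X) (g₀ : G), ∀ ε : ℝ, 0 < ε →
    ∀ᶠ g in nhds g₀, S.dist (act g x) (act g₀ x) < ε

/-- The action is (metrically) proper: for some basepoint `x₀`, the sets
`{g | d(act g x₀, x₀) ≤ R}` are relatively compact. -/
def IsProperAction {G : Type*} [Group G] [TopologicalSpace G]
    (S : LabelledPartitionSpace X) (act : G → X → X) : Prop :=
  ∃ x₀ : X, ∀ R : ℝ, IsCompact (closure {g : G | S.dist (act g x₀) x₀ ≤ R})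

/-- The action of a (countable) discrete group is proper: for some basepoint `x₀`, the sets
`{g | d(act g x₀, x₀) ≤ R}` are finite. -/
def IsProperActionDiscrete {G : Type*} [Group G]
    (S : LabelledPartitionSpace X) (act : G → X → X) : Prop :=
  ∃ x₀ : X, ∀ R : ℝ, {g : G | S.dist (act g x₀) x₀ ≤ R}.Finite

/-- A homomorphism of spaces with labelled partitions: `Φ_f(p') = p' ∘ f` maps `𝒫'` into
`𝒫`, and precomposition with `Φ_f` maps `ℱ(𝒫)` into `ℱ'(𝒫')` preserving the seminorms. -/
def IsHomomorphism (S : LabelledPartitionSpace X) (S' : LabelledPartitionSpace X')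
    (f : X → X') : Prop :=
  ∃ hP : ∀ p' : ↥S'.P, (fun x => (p' : X' → ℝ) (f x)) ∈ S.P,
    ∀ ξ : ↥S.Fcal,
      ∃ hmem : (fun p' : ↥S'.P =>
          (ξ : ↥S.P → ℝ) ⟨fun x => (p' : X' → ℝ) (f x), hP p'⟩) ∈ S'.Fcal,
        S'.N ⟨_, hmem⟩ = S.N ξ

end LabelledPartitionSpace

/-- A continuous isometric affine action of a topological group `G` on a real normed space
`B`: a strongly continuous linear isometric representation `π` together with a continuous
cocycle `b`, acting by `α(g)x = π(g)x + b(g)`. -/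
structure IsometricAffineAction (G B : Type*) [Group G] [TopologicalSpace G]
    [NormedAddCommGroup B] [NormedSpace ℝ B] where
  π : G →* (B ≃ₗᵢ[ℝ] B)
  b : G → B
  cocycle : ∀ g h : G, b (g * h) = π g (b h) + b g
  strongly_continuous : ∀ v : B, Continuous fun g : G => π g v
  continuous_b : Continuous b

/-- Properness of an isometric affine action: the sets `{g | ‖b g‖ ≤ R}` are relatively
compact. -/
def IsometricAffineAction.Proper {G B : Type*} [Group G] [TopologicalSpace G]
    [NormedAddCommGroup B] [NormedSpace ℝ B] (α : IsometricAffineAction G B) : Prop :=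
  ∀ R : ℝ, IsCompact (closure {g : G | ‖α.b g‖ ≤ R})

/-- A topological group `G` has property `PL^p`: it admits a proper continuous isometric
affine action on some `L^p` space. -/
def HasPLp (G : Type*) [Group G] [TopologicalSpace G] (p : ℝ) : Prop :=
  ∃ (Ω : Type) (_ : MeasurableSpace Ω) (μ : Measure Ω)
    (_ : Fact (1 ≤ ENNReal.ofReal p))
    (α : IsometricAffineAction G (Lp ℝ (ENNReal.ofReal p) μ)), α.Proper


namespace LabelledPartitionSpace

section Dual

variable {X B : Type*} [SeminormedAddCommGroup B] [NormedSpace ℝ B]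

/-- The functions on `X` whose increments are those of a continuous linear functional
along `b : X → B`. -/
def dualLabelling (b : X → B) : Set (X → ℝ) :=
  {p | ∃ φ : StrongDual ℝ B, ∀ x y, p x - p y = φ (b x - b y)}

/-- The closed linear span of the differences `b x - b y`. -/
def differenceSpace (b : X → B) : Submodule ℝ B :=
  (Submodule.span ℝ {v | ∃ x y, b x - b y = v}).topologicalClosure

theorem sub_mem_differenceSpace (b : X → B) (x y : X) : b x - b y ∈ differenceSpace b :=
  Submodule.le_topologicalClosure _ (Submodule.subset_span ⟨x, y, rfl⟩)

/-- A closed submodule containing all differences contains `differenceSpace b`. -/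
theorem differenceSpace_le {b : X → B} {W : Submodule ℝ B} (hW : IsClosed (W : Set B))
    (h : ∀ x y, b x - b y ∈ W) : differenceSpace b ≤ W :=
  Submodule.topologicalClosure_minimal _
    (Submodule.span_le.2 (by rintro _ ⟨x, y, rfl⟩; exact h x y)) hW

/-- Evaluation of labelling functions, through the functionals they come from, on
`differenceSpace b`. -/
def pairing (b : X → B) : ↥(differenceSpace b) →ₗ[ℝ] (↥(dualLabelling b) → ℝ) :=
  LinearMap.pi fun p => (p.2.choose : B →ₗ[ℝ] ℝ) ∘ₗ (differenceSpace b).subtype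

theorem pairing_apply (b : X → B) (v : ↥(differenceSpace b)) (p : ↥(dualLabelling b))
    (φ : StrongDual ℝ B) (hφ : ∀ x y, (p : X → ℝ) x - (p : X → ℝ) y = φ (b x - b y)) :
    pairing b v p = φ v := by
  have hle : differenceSpace b ≤
      LinearMap.ker ((p.2.choose - φ : StrongDual ℝ B) : B →ₗ[ℝ] ℝ) := by
    refine differenceSpace_le (ContinuousLinearMap.isClosed_ker (p.2.choose - φ)) fun x y => ?_
    have h := p.2.choose_spec x y
    rw [hφ] at h
    simp only [LinearMap.mem_ker, ContinuousLinearMap.coe_coe, sub_apply]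
    linarith
  have h := hle v.2
  simp only [LinearMap.mem_ker, ContinuousLinearMap.coe_coe, sub_apply] at h
  exact sub_eq_zero.1 h

theorem pairing_sub (b : X → B) (x y : X) (p : ↥(dualLabelling b)) :
    pairing b ⟨b x - b y, sub_mem_differenceSpace b x y⟩ p = (p : X → ℝ) x - (p : X → ℝ) y := by
  obtain ⟨φ, hφ⟩ := p.2
  rw [pairing_apply b _ p φ hφ, hφ]

/-- The pairing separates vectors up to the seminorm. -/
theorem norm_eq_of_pairing_eq (b : X → B) {v w : ↥(differenceSpace b)}
    (h : pairing b v = pairing b w) : ‖v‖ = ‖w‖ := by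
  have h0 : ‖v - w‖ = 0 := by
    obtain ⟨φ, -, hφ⟩ := exists_dual_vector'' ℝ ((v - w : ↥(differenceSpace b)) : B)
    let p : ↥(dualLabelling b) := ⟨fun x => φ (b x), φ, fun x y => (map_sub φ _ _).symm⟩
    have hp := pairing_apply b (v - w) p φ fun x y => (map_sub φ _ _).symm
    rw [map_sub, h, sub_self, hφ] at hp
    exact hp.symm
  have h1 := abs_norm_sub_norm_le v w
  rw [h0] at h1
  exact sub_eq_zero.1 (abs_nonpos_iff.1 h1)

/-- A linear section of `pairing b` over its range. -/
def pairingSection (b : X → B) : ↥(LinearMap.range (pairing b)) →ₗ[ℝ] ↥(differenceSpace b) :=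
  ((pairing b).rangeRestrict.exists_rightInverse_of_surjective
    (LinearMap.range_rangeRestrict _)).choose

theorem pairing_pairingSection (b : X → B) (ξ : ↥(LinearMap.range (pairing b))) :
    pairing b (pairingSection b ξ) = ξ := by
  have h := ((pairing b).rangeRestrict.exists_rightInverse_of_surjective
    (LinearMap.range_rangeRestrict _)).choose_spec
  exact congrArg Subtype.val (LinearMap.congr_fun h ξ)

theorem norm_pairingSection (b : X → B) (ξ : ↥(LinearMap.range (pairing b)))
    (v : ↥(differenceSpace b)) (h : pairing b v = ξ) : ‖pairingSection b ξ‖ = ‖v‖ :=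
  norm_eq_of_pairing_eq b ((pairing_pairingSection b ξ).trans h.symm)

/-- The labelled partition structure induced on `X` by a map into a complete seminormed
space. -/
def ofMap [CompleteSpace B] (b : X → B) : LabelledPartitionSpace X where
  P := dualLabelling b
  Fcal := LinearMap.range (pairing b)
  N ξ := ‖pairingSection b ξ‖
  N_nonneg _ := norm_nonneg _
  N_add_le ξ η := by rw [map_add]; exact norm_add_le _ _
  N_smul a ξ := by rw [map_smul, norm_smul, Real.norm_eq_abs]
  sep_mem x y := ⟨⟨b x - b y, sub_mem_differenceSpace b x y⟩, funext (pairing_sub b x y)⟩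
  complete u hu := by
    have : CompleteSpace ↥(differenceSpace b) :=
      (Submodule.isClosed_topologicalClosure _).completeSpace_coe
    have hc : CauchySeq fun n => pairingSection b (u n) := by
      refine Metric.cauchySeq_iff.2 fun ε hε => (hu ε hε).imp fun M hM m hm n hn => ?_
      rw [dist_eq_norm, ← map_sub]
      exact hM m hm n hn
    obtain ⟨v, hv⟩ := cauchySeq_tendsto_of_complete hc
    refine ⟨⟨pairing b v, v, rfl⟩, fun ε hε => ?_⟩
    refine (Metric.tendsto_atTop.1 hv ε hε).imp fun M hM n hn => ?_
    have h := hM n hn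
    rw [dist_eq_norm] at h
    rwa [norm_pairingSection b _ (pairingSection b (u n) - v)]
    rw [map_sub, pairing_pairingSection]
    rfl

theorem ofMap_dist [CompleteSpace B] (b : X → B) (x y : X) :
    (ofMap b).dist x y = ‖b x - b y‖ :=
  norm_pairingSection b _ ⟨b x - b y, sub_mem_differenceSpace b x y⟩
    (funext (pairing_sub b x y))

/-- An action whose differences `b x - b y` are moved by linear isometries acts by
automorphisms on `ofMap b`. -/
theorem ofMap_isActionByAutomorphisms [CompleteSpace B] {G : Type*} [Group G] [MulAction G X]
    (b : X → B) (ρ : G → B →ₗᵢ[ℝ] B)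
    (hρ : ∀ g x y, ρ g (b x - b y) = b (g • x) - b (g • y)) :
    (ofMap b).IsActionByAutomorphisms fun (g : G) (x : X) => g • x := by
  have key : ∀ (g : G) (p : X → ℝ) (φ : StrongDual ℝ B),
      (∀ x y, p x - p y = φ (b x - b y)) →
      ∀ x y, p (g • x) - p (g • y) = (φ.comp (ρ g).toContinuousLinearMap) (b x - b y) := by
    intro g p φ hφ x y
    rw [hφ, ← hρ]
    rfl
  refine ⟨one_smul G, mul_smul, fun g p => ?_, fun g ξ => ?_⟩
  · obtain ⟨φ, hφ⟩ := p.2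
    exact ⟨_, key g p φ hφ⟩
  · obtain ⟨v, hv⟩ := ξ.2
    have hmem : ρ g v ∈ differenceSpace b := by
      have hle : differenceSpace b ≤ (differenceSpace b).comap (ρ g).toLinearMap := by
        refine differenceSpace_le ?_ fun x y => ?_
        · exact (Submodule.isClosed_topologicalClosure _).preimage (ρ g).continuous
        · change ρ g (b x - b y) ∈ differenceSpace b
          rw [hρ]
          exact sub_mem_differenceSpace b _ _
      exact hle v.2
    have hL : pairing b ⟨ρ g v, hmem⟩ = fun p : ↥(dualLabelling b) =>
        ξ.1 ⟨fun x => (p : X → ℝ) (g • x),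
          ⟨_, key g p p.2.choose p.2.choose_spec⟩⟩ := by
      funext p
      obtain ⟨φ, hφ⟩ := p.2
      rw [pairing_apply b _ p φ hφ, ← hv]
      exact (pairing_apply b v ⟨fun x => (p : X → ℝ) (g • x), _, key g p φ hφ⟩ _
        (key g p φ hφ)).symm
    refine ⟨⟨_, hL⟩, ?_⟩
    exact (norm_pairingSection b _ _ hL).trans
      (((ρ g).norm_map v).trans (norm_pairingSection b ξ v hv).symm)

end Dual

section Seminormed

variable {X : Type*} (S : LabelledPartitionSpace X)

/-- The space `ℱ(𝒫)`, as a type carrying the topology of its seminorm. -/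
def Carrier : Type _ := ↥S.Fcal

instance : AddCommGroup S.Carrier := inferInstanceAs (AddCommGroup ↥S.Fcal)

instance : Module ℝ S.Carrier := inferInstanceAs (Module ℝ ↥S.Fcal)

instance : Norm S.Carrier := ⟨S.N⟩

theorem carrier_core : SeminormedSpace.Core ℝ S.Carrier where
  norm_nonneg := S.N_nonneg
  norm_smul := S.N_smul
  norm_triangle := S.N_add_le

instance : SeminormedAddCommGroup S.Carrier := SeminormedAddCommGroup.ofCore S.carrier_core

instance : NormedSpace ℝ S.Carrier where
  norm_smul_le a ξ := (S.N_smul a ξ).le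

instance : CompleteSpace S.Carrier := by
  refine Metric.complete_of_cauchySeq_tendsto fun u hu => ?_
  obtain ⟨ξ, hξ⟩ := S.complete u fun ε hε =>
    (Metric.cauchySeq_iff.1 hu ε hε).imp fun M hM m hm n hn => by
      have h := hM m hm n hn
      rwa [dist_eq_norm] at h
  let η : S.Carrier := ξ
  refine ⟨η, Metric.tendsto_atTop.2 fun ε hε => (hξ ε hε).imp fun M hM n hn => ?_⟩
  rw [dist_eq_norm]
  exact hM n hn

/-- The separation map with values in `S.Carrier`. -/
def sep (x y : X) : S.Carrier := S.c x y

theorem norm_sep (x y : X) : ‖S.sep x y‖ = S.dist x y := rfl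

theorem sep_add_sep (x y z : X) : S.sep x y + S.sep y z = S.sep x z :=
  Subtype.ext (funext fun p => sub_add_sub_cancel ((p : X → ℝ) x) (p.1 y) (p.1 z))

theorem sep_sub_sep (x y z : X) : S.sep x z - S.sep y z = S.sep x y :=
  sub_eq_of_eq_add (S.sep_add_sep x y z).symm

theorem neg_sep (x y : X) : -S.sep x y = S.sep y x :=
  Subtype.ext (funext fun p => neg_sub ((p : X → ℝ) x) (p.1 y))

/-- An action by automorphisms induces linear isometries moving the separation functions. -/
theorem IsActionByAutomorphisms.exists_linearIsometry {S : LabelledPartitionSpace X}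
    {G : Type*} [Group G] {act : G → X → X} (h : S.IsActionByAutomorphisms act) (g : G) :
    ∃ ρ : S.Carrier →ₗᵢ[ℝ] S.Carrier, ∀ x y, ρ (S.sep x y) = S.sep (act g x) (act g y) := by
  obtain ⟨-, -, hP, hF⟩ := h
  choose hmem hN using hF
  exact ⟨⟨⟨⟨fun ξ => (⟨_, hmem g ξ⟩ : ↥S.Fcal), fun _ _ => rfl⟩, fun _ _ => rfl⟩, hN g⟩,
    fun _ _ => rfl⟩

end Seminormed

section Average

variable {G : Type*} [Group G] (F : Subgroup G) [Fintype ↥F] (S : LabelledPartitionSpace G)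

/-- The average over a finite subgroup `F` of the separation functions `c (g f) 1`. -/
def cosetAverage : G ⧸ F → S.Carrier :=
  Quotient.lift (fun g : G => (Fintype.card ↥F : ℝ)⁻¹ • ∑ f : ↥F, S.sep (g * f) 1) <| by
    intro g g' h
    have hm : g⁻¹ * g' ∈ F := QuotientGroup.leftRel_apply.1 h
    refine congrArg _ (Fintype.sum_equiv (Equiv.mulLeft (⟨g⁻¹ * g', hm⟩ : ↥F)⁻¹) _ _ fun f => ?_)
    simp [mul_assoc]

theorem cosetAverage_sub (g g' : G) :
    cosetAverage F S (g : G ⧸ F) - cosetAverage F S (g' : G ⧸ F) =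
      (Fintype.card ↥F : ℝ)⁻¹ • ∑ f : ↥F, S.sep (g * f) (g' * f) := by
  change (Fintype.card ↥F : ℝ)⁻¹ • ∑ f : ↥F, S.sep (g * f) 1 -
    (Fintype.card ↥F : ℝ)⁻¹ • ∑ f : ↥F, S.sep (g' * f) 1 = _
  rw [← smul_sub, ← Finset.sum_sub_distrib]
  simp only [sep_sub_sep]

theorem norm_cosetAverage_sub_sep_le
    (hact : S.IsActionByAutomorphisms (fun g x : G => g * x)) (g g' : G) :
    ‖cosetAverage F S (g : G ⧸ F) - cosetAverage F S (g' : G ⧸ F) - S.sep g g'‖ ≤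
      (Fintype.card ↥F : ℝ)⁻¹ * ∑ f : ↥F, 2 * S.dist f 1 := by
  have hcard : (Fintype.card ↥F : ℝ) ≠ 0 := Nat.cast_ne_zero.2 Fintype.card_ne_zero
  have hinv : ∀ a x y : G, ‖S.sep (a * x) (a * y)‖ = ‖S.sep x y‖ := fun a x y => by
    obtain ⟨ρ, hρ⟩ := hact.exists_linearIsometry a
    rw [← hρ, ρ.norm_map]
  have hsum : cosetAverage F S (g : G ⧸ F) - cosetAverage F S (g' : G ⧸ F) - S.sep g g' =
      (Fintype.card ↥F : ℝ)⁻¹ • ∑ f : ↥F, (S.sep (g * f) (g' * f) - S.sep g g') := by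
    rw [cosetAverage_sub, Finset.sum_sub_distrib, smul_sub, Finset.sum_const, Finset.card_univ,
      ← Nat.cast_smul_eq_nsmul ℝ, inv_smul_smul₀ hcard]
  rw [hsum, norm_smul, norm_inv, Real.norm_natCast]
  gcongr
  refine (norm_sum_le _ _).trans (Finset.sum_le_sum fun f _ => ?_)
  have h : S.sep (g * f) (g' * f) - S.sep g g' =
      S.sep (g * f) (g * 1) - S.sep (g' * f) (g' * 1) := by
    rw [mul_one, mul_one, ← S.sep_add_sep (g * f) g (g' * f), ← S.sep_add_sep g g' (g' * f),
      ← S.neg_sep (g' * f) g']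
    abel
  rw [h]
  refine (norm_sub_le _ _).trans_eq ?_
  rw [hinv, hinv, norm_sep, two_mul]

end Average

end LabelledPartitionSpace

/-- Let `G` be a group, `F` a finite subgroup, and `(G,𝒫,F(𝒫))` a space
with labelled partitions on which `G` acts by automorphisms via left translations. Then
there is a space with labelled partitions `(G/F, 𝒫', F'(𝒫'))` on which `G` acts by
automorphisms via its natural action on `G/F`, with `F'(𝒫')` isometrically isomorphic to a
closed subspace of `F(𝒫)`, and a constant `K ≥ 0` with
`‖c(g,g')‖ − K ≤ ‖c'(gF,g'F)‖ ≤ ‖c(g,g')‖ + K` for all `g, g'`. In particular, for a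
countable discrete `G`, the action on `(G,𝒫,F(𝒫))` is proper iff the action on
`(G/F, 𝒫', F'(𝒫'))` is proper. -/
theorem statement16 (G : Type) [Group G] [Countable G] (F : Subgroup G) [Finite ↥F]
    (S : LabelledPartitionSpace G)
    (hact : S.IsActionByAutomorphisms (fun g x : G => g * x)) :
    ∃ S' : LabelledPartitionSpace (G ⧸ F),
      S'.IsActionByAutomorphisms (fun (g : G) (x : G ⧸ F) => g • x) ∧
      (∃ T : ↥S'.Fcal →ₗ[ℝ] ↥S.Fcal, ∀ ξ : ↥S'.Fcal, S.N (T ξ) = S'.N ξ) ∧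
      (∃ K : ℝ, 0 ≤ K ∧ ∀ g g' : G,
        S.dist g g' - K ≤ S'.dist (g : G ⧸ F) (g' : G ⧸ F) ∧
        S'.dist (g : G ⧸ F) (g' : G ⧸ F) ≤ S.dist g g' + K) ∧
      (S.IsProperActionDiscrete (fun g x : G => g * x) ↔
        S'.IsProperActionDiscrete (fun (g : G) (x : G ⧸ F) => g • x)) := by
  have := Fintype.ofFinite ↥F
  choose ρ hρ using fun g : G => hact.exists_linearIsometry g
  let b := LabelledPartitionSpace.cosetAverage F S
  have hdist : ∃ K : ℝ, 0 ≤ K ∧ ∀ g g' : G,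
      S.dist g g' - K ≤ (LabelledPartitionSpace.ofMap b).dist (g : G ⧸ F) (g' : G ⧸ F) ∧
      (LabelledPartitionSpace.ofMap b).dist (g : G ⧸ F) (g' : G ⧸ F) ≤ S.dist g g' + K := by
    refine ⟨(Fintype.card ↥F : ℝ)⁻¹ * ∑ f : ↥F, 2 * S.dist f 1,
      (norm_nonneg _).trans (S.norm_cosetAverage_sub_sep_le F hact 1 1), fun g g' => ?_⟩
    have h := abs_le.1 ((abs_norm_sub_norm_le _ _).trans
      (S.norm_cosetAverage_sub_sep_le F hact g g'))
    rw [LabelledPartitionSpace.ofMap_dist, ← S.norm_sep]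
    constructor <;> linarith [h.1, h.2]
  refine ⟨LabelledPartitionSpace.ofMap b,
    LabelledPartitionSpace.ofMap_isActionByAutomorphisms b ρ ?_,
    ⟨(LabelledPartitionSpace.differenceSpace b).subtype ∘ₗ
      LabelledPartitionSpace.pairingSection b, fun _ => rfl⟩, hdist, ?_⟩
  · intro g x y
    induction x using QuotientGroup.induction_on with | H x => ?_
    induction y using QuotientGroup.induction_on with | H y => ?_
    rw [MulAction.Quotient.smul_coe, MulAction.Quotient.smul_coe,
      LabelledPartitionSpace.cosetAverage_sub, LabelledPartitionSpace.cosetAverage_sub, map_smul,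
      map_sum]
    simp only [hρ, smul_eq_mul, mul_assoc]
  · obtain ⟨K, -, hK⟩ := hdist
    constructor
    · rintro ⟨x, hx⟩
      refine ⟨(x : G ⧸ F), fun R => (hx (R + K)).subset fun g hg => ?_⟩
      exact sub_le_iff_le_add.1 ((hK (g * x) x).1.trans hg)
    · rintro ⟨x, hx⟩
      induction x using QuotientGroup.induction_on with | H x => ?_
      refine ⟨x, fun R => (hx (R + K)).subset fun g hg => ?_⟩
      exact (hK (g * x) x).2.trans (add_le_add hg le_rfl)

end
end
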